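/- For integers t > k ≥ 3 and every constant γ > 0 there exists an integer n₀ = n₀(k, t, γ) such that for every n ≥ n₀ divisible by t, every k-graph H on n vertices with δ_{k−1}(H) ≥ (1 − min{ β(k,t), (t−1)/(t·C(t−1,k−1)) } + γ)·n contains a K_t^k-factor. -/

import Mathlib

open Finset

/-- `A` is the vertex set of a copy of the hypergraph with vertex type `V` and edge set `EF`
inside the hypergraph on `Fin n` with edge set `E`. -/
def IsCopy {n : ℕ} {V : Type} [Fintype V] [DecidableEq V] (E : Finset (Finset (Fin n)))
    (EF : Finset (Finset V)) (A : Finset (Fin n)) : Prop :=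
  ∃ f : V ↪ Fin n, Finset.map f Finset.univ = A ∧ ∀ e ∈ EF, e.map f ∈ E

/-- The induced subhypergraph of `E` on `S` has an `F`-factor, where `F` has vertex type `V`
and edge set `EF`: there are pairwise vertex-disjoint copies of `F` covering exactly `S`. -/
def HasFactorOn {n : ℕ} {V : Type} [Fintype V] [DecidableEq V] (E : Finset (Finset (Fin n)))
    (EF : Finset (Finset V)) (S : Finset (Fin n)) : Prop :=
  ∃ P : Finset (Finset (Fin n)), (∀ A ∈ P, IsCopy E EF A) ∧
    (P : Set (Finset (Fin n))).PairwiseDisjoint id ∧ P.biUnion id = S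

/-- `x` is `(F, i, η)`-close to `y`. -/
def CloseTo {n : ℕ} {V : Type} [Fintype V] [DecidableEq V] (E : Finset (Finset (Fin n)))
    (EF : Finset (Finset V)) (i : ℕ) (η : ℝ) (x y : Fin n) : Prop :=
  η * (n : ℝ) ^ (i * Fintype.card V - 1) ≤
    (({S : Finset (Fin n) | S.card = i * Fintype.card V - 1 ∧ x ∉ S ∧ y ∉ S ∧
      HasFactorOn E EF (insert x S) ∧ HasFactorOn E EF (insert y S)}).ncard : ℝ)

/-- `H` is `(F, i, η)`-closed. -/
def IsClosedGraph {n : ℕ} {V : Type} [Fintype V] [DecidableEq V] (E : Finset (Finset (Fin n)))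
    (EF : Finset (Finset V)) (i : ℕ) (η : ℝ) : Prop :=
  ∀ x y : Fin n, x ≠ y → CloseTo E EF i η x y

/-- `Ñ_{F,i,η}(x)`: the set of vertices `(F, i, η)`-close to `x`. -/
def Ntilde {n : ℕ} {V : Type} [Fintype V] [DecidableEq V] (E : Finset (Finset (Fin n)))
    (EF : Finset (Finset V)) (i : ℕ) (η : ℝ) (x : Fin n) : Set (Fin n) :=
  {y | CloseTo E EF i η x y}

/-- Degree of the set `T` in the `k`-graph with edge set `E`. -/
noncomputable def degOn {n : ℕ} (E : Finset (Finset (Fin n))) (k : ℕ) (T : Finset (Fin n)) : ℕ :=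
  ({S : Finset (Fin n) | S.card = k - T.card ∧ Disjoint S T ∧ S ∪ T ∈ E}).ncard

/-- Edge set of the complete `k`-graph `K_t^k` on `Fin t`. -/
def cliqueEdges (t k : ℕ) : Finset (Finset (Fin t)) :=
  Finset.powersetCard k (Finset.univ : Finset (Fin t))

/-- Edge set of the complete `k`-partite `k`-graph `K_k^k(m)` with parts of size `m`. -/
def multipartiteEdges (k m : ℕ) : Finset (Finset (Fin k × Fin m)) :=
  Finset.univ.filter (fun e : Finset (Fin k × Fin m) =>
    ∀ i : Fin k, (e.filter (fun v => v.1 = i)).card = 1)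

/-- `β(k,t,l)` from the paper. -/
noncomputable def betaL (k t l : ℕ) : ℝ :=
  2 / ((t.choose (k - 1) : ℝ) + ((t - l - 1).choose (k - 1) : ℝ) + ((l + 1).choose (k - 1) : ℝ))

/-- The defining conditions for `l₀(k,t)` when `k ≥ 4`. -/
def GoodL (k t l : ℕ) : Prop :=
  2 * (l + 1) ≤ t ∧
  betaL k t l ≤ 1 / (((t - 1).choose (k - 1) : ℝ) + (l.choose (k - 1) : ℝ)) ∧
  (0 < (2 * l + 1).choose (k - 1) →
    betaL k t l ≤ 1 / (2 * ((2 * l + 1).choose (k - 1) : ℝ)))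

/-- `l₀(k,t)`: equal to `1` when `k = 3`, and the largest `l` satisfying `GoodL k t l`
when `k ≥ 4`. -/
noncomputable def l0 (k t : ℕ) : ℕ := if k = 3 then 1 else sSup {l | GoodL k t l}

/-- `β(k,t) = β(k,t,l₀(k,t))`. -/
noncomputable def betaKT (k t : ℕ) : ℝ := betaL k t (l0 k t)

/-- `d(k,t) = 1 - C(t-1,k-1)·β(k,t)`. -/
noncomputable def dKT (k t : ℕ) : ℝ := 1 - ((t - 1).choose (k - 1) : ℝ) * betaKT k t

/-- The indicator of a proposition, as a real number. -/
noncomputable def ind (p : Prop) : ℝ := by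
  classical exact if p then 1 else 0

theorem ind_true {p : Prop} (h : p) : ind p = 1 := by simp [ind, h]

theorem ind_false {p : Prop} (h : ¬ p) : ind p = 0 := by simp [ind, h]

theorem ind_nonneg (p : Prop) : 0 ≤ ind p := by
  by_cases h : p <;> simp [ind, h]

theorem ind_le_one (p : Prop) : ind p ≤ 1 := by
  by_cases h : p <;> simp [ind, h]

theorem ind_mono {p q : Prop} (h : p → q) : ind p ≤ ind q := by
  by_cases hp : p
  · simp [ind, hp, h hp]
  · rw [ind_false hp]
    exact ind_nonneg q

theorem ind_mul {p q r : Prop} (h : p → q → r) : ind p * ind q ≤ ind r := by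
  by_cases hp : p
  · by_cases hq : q
    · simp [ind, hp, hq, h hp hq]
    · rw [ind_false hq, mul_zero]
      exact ind_nonneg r
  · rw [ind_false hp, zero_mul]
    exact ind_nonneg r

theorem ind_le_add {p q r : Prop} (h : p → q ∨ r) : ind p ≤ ind q + ind r := by
  by_cases hp : p
  · rw [ind_true hp]
    rcases h hp with h | h
    · rw [ind_true h]
      linarith [ind_nonneg r]
    · rw [ind_true h]
      linarith [ind_nonneg q]
  · rw [ind_false hp]
    linarith [ind_nonneg q, ind_nonneg r]

theorem sum_ind {α : Type*} (s : Finset α) (p : α → Prop) [DecidablePred p] :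
    ∑ a ∈ s, ind (p a) = ((s.filter p).card : ℝ) := by
  rw [Finset.card_filter]
  push_cast
  refine Finset.sum_congr rfl fun a _ => ?_
  by_cases h : p a <;> simp [ind, h]

section Averages

variable {V : Type*} [Fintype V]

/-- The average of `f` over all vertices. -/
noncomputable def av (f : V → ℝ) : ℝ := (∑ v, f v) / (Fintype.card V : ℝ)

/-- The average of `f` over all lists of vertices of length `m`. -/
noncomputable def avg : ℕ → (List V → ℝ) → ℝ
  | 0, f => f []
  | m + 1, f => av fun v => avg m fun l => f (v :: l)

theorem av_mono {f g : V → ℝ} (h : ∀ v, f v ≤ g v) : av f ≤ av g := by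
  unfold av
  gcongr with v _
  exact h v

theorem av_add (f g : V → ℝ) : av (fun v => f v + g v) = av f + av g := by
  simp [av, Finset.sum_add_distrib, add_div]

theorem av_const_mul (c : ℝ) (f : V → ℝ) : av (fun v => c * f v) = c * av f := by
  simp [av, ← Finset.mul_sum, mul_div_assoc]

theorem av_mul_const (c : ℝ) (f : V → ℝ) : av (fun v => f v * c) = av f * c := by
  simp only [mul_comm _ c, av_const_mul]

theorem av_nonneg {f : V → ℝ} (h : ∀ v, 0 ≤ f v) : 0 ≤ av f :=
  div_nonneg (Finset.sum_nonneg fun v _ => h v) (Nat.cast_nonneg _)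

theorem av_const [Nonempty V] (c : ℝ) : av (fun _ : V => c) = c := by
  simp [av]

theorem av_comm (f : V → V → ℝ) :
    av (fun u => av fun v => f u v) = av fun v => av fun u => f u v := by
  unfold av
  simp only [← Finset.sum_div]
  rw [Finset.sum_comm]

theorem av_ind (p : V → Prop) [DecidablePred p] :
    av (fun v => ind (p v)) = ((univ.filter p).card : ℝ) / (Fintype.card V : ℝ) := by
  rw [av, sum_ind]

theorem avg_mono {m : ℕ} {f g : List V → ℝ} (h : ∀ l, l.length = m → f l ≤ g l) :
    avg m f ≤ avg m g := by
  induction m generalizing f g with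
  | zero => exact h [] rfl
  | succ m ih => exact av_mono fun v => ih fun l hl => h _ (by simp [hl])

theorem avg_add (m : ℕ) (f g : List V → ℝ) :
    avg m (fun l => f l + g l) = avg m f + avg m g := by
  induction m generalizing f g with
  | zero => rfl
  | succ m ih => simp only [avg, ih, av_add]

theorem avg_const_mul (m : ℕ) (c : ℝ) (f : List V → ℝ) :
    avg m (fun l => c * f l) = c * avg m f := by
  induction m generalizing f with
  | zero => rfl
  | succ m ih => simp only [avg, ih, av_const_mul]

theorem avg_mul_const (m : ℕ) (c : ℝ) (f : List V → ℝ) :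
    avg m (fun l => f l * c) = avg m f * c := by
  simp only [mul_comm _ c, avg_const_mul]

theorem avg_nonneg {m : ℕ} {f : List V → ℝ} (h : ∀ l, 0 ≤ f l) : 0 ≤ avg m f := by
  induction m generalizing f with
  | zero => exact h _
  | succ m ih => exact av_nonneg fun v => ih fun l => h _

theorem avg_const [Nonempty V] (m : ℕ) (c : ℝ) : avg m (fun _ : List V => c) = c := by
  induction m with
  | zero => rfl
  | succ m ih => simp only [avg, ih, av_const]

theorem avg_sum {ι : Type*} (s : Finset ι) (m : ℕ) (f : ι → List V → ℝ) :
    avg m (fun l => ∑ i ∈ s, f i l) = ∑ i ∈ s, avg m (f i) := by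
  classical
  induction s using Finset.induction_on with
  | empty => simpa using avg_const_mul m 0 (fun _ : List V => (0 : ℝ))
  | insert a s ha ih => simp only [Finset.sum_insert ha, avg_add, ih]

theorem avg_av (m : ℕ) (f : List V → V → ℝ) :
    avg m (fun l => av fun v => f l v) = av fun v => avg m fun l => f l v := by
  unfold av
  simp only [div_eq_mul_inv, avg_mul_const, avg_sum]

theorem avg_comm (a b : ℕ) (f : List V → List V → ℝ) :
    avg a (fun l => avg b fun l' => f l l') = avg b fun l' => avg a fun l => f l l' := by
  induction b generalizing f with
  | zero => rfl
  | succ b ih =>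
    simp only [avg, avg_av]
    congr 1
    funext v
    exact ih _

theorem avg_append (a b : ℕ) (f : List V → ℝ) :
    avg (a + b) f = avg a fun l => avg b fun l' => f (l ++ l') := by
  induction a generalizing f with
  | zero => simp [avg]
  | succ a ih =>
    rw [Nat.add_right_comm]
    simp only [avg, ih, List.cons_append]

theorem exists_avg_le [Nonempty V] (m : ℕ) (f : List V → ℝ) :
    ∃ l : List V, l.length = m ∧ avg m f ≤ f l := by
  induction m generalizing f with
  | zero => exact ⟨[], rfl, le_rfl⟩
  | succ m ih =>
    obtain ⟨v, -, hv⟩ := Finset.exists_max_image (univ : Finset V)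
      (fun v => avg m fun l => f (v :: l)) univ_nonempty
    obtain ⟨l, hl, h⟩ := ih fun l => f (v :: l)
    refine ⟨v :: l, by simp [hl], le_trans ?_ h⟩
    calc avg (m + 1) f ≤ av fun _ : V => avg m fun l => f (v :: l) :=
          av_mono fun u => hv u (mem_univ u)
      _ = _ := av_const _

/-- Lists are extended one entry at a time. -/
theorem avg_succ_ge {m : ℕ} {P Q : List V → Prop} {c p : ℝ} (hc : 0 ≤ c)
    (hP : p ≤ avg m fun l => ind (P l))
    (h : ∀ l, l.length = m → P l → c ≤ av fun v => ind (Q (v :: l))) :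
    c * p ≤ avg (m + 1) fun l => ind (Q l) := by
  calc c * p ≤ c * avg m fun l => ind (P l) := by gcongr
    _ = avg m fun l => c * ind (P l) := (avg_const_mul _ _ _).symm
    _ ≤ avg m fun l => av fun v => ind (Q (v :: l)) := by
      refine avg_mono fun l hl => ?_
      by_cases hp : P l
      · rw [ind_true hp, mul_one]
        exact h l hl hp
      · rw [ind_false hp, mul_zero]
        exact av_nonneg fun v => ind_nonneg _
    _ = _ := avg_av _ _

theorem avg_succ_iter {m j : ℕ} {P : List V → Prop} {c p : ℝ} (hc : 0 ≤ c)
    (hP : p ≤ avg m fun l => ind (P l))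
    (h : ∀ l, l.length < m + j → P l → c ≤ av fun v => ind (P (v :: l))) :
    c ^ j * p ≤ avg (m + j) fun l => ind (P l) := by
  induction j with
  | zero => simpa using hP
  | succ j ih =>
    rw [pow_succ', mul_assoc]
    refine avg_succ_ge hc (ih fun l hl => h l (by omega)) fun l hl => h l ?_
    have : l.length = m + j := hl
    omega

/-- A function with values in `[0, b]` and large average is often large. -/
theorem av_ind_ge {f : V → ℝ} {a b : ℝ} (ha : 0 ≤ a) (hf : ∀ v, f v ≤ b) [Nonempty V] :
    av f ≤ b * av (fun v => ind (a ≤ f v)) + a := by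
  calc av f ≤ av fun v => b * ind (a ≤ f v) + a := by
        refine av_mono fun v => ?_
        by_cases h : a ≤ f v
        · rw [ind_true h]
          linarith [hf v]
        · rw [ind_false h]
          linarith
    _ = _ := by rw [av_add, av_const_mul, av_const]

variable [DecidableEq V]

theorem avg_degenerate (m : ℕ) (Z : Finset V) :
    avg m (fun l => ind (¬ (l.Nodup ∧ Disjoint l.toFinset Z))) ≤
      (m : ℝ) * (m + Z.card) / (Fintype.card V : ℝ) := by
  induction m generalizing Z with
  | zero => simp [avg, ind]
  | succ m ih =>
    have key : ∀ v : V, (avg m fun l => ind (¬ ((v :: l).Nodup ∧ Disjoint (v :: l).toFinset Z))) ≤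
        ind (v ∈ Z) + (m : ℝ) * (m + (Z.card + 1)) / (Fintype.card V : ℝ) := by
      intro v
      have : Nonempty V := ⟨v⟩
      calc (avg m fun l => ind (¬ ((v :: l).Nodup ∧ Disjoint (v :: l).toFinset Z)))
          ≤ avg m fun l => ind (v ∈ Z) + ind (¬ (l.Nodup ∧ Disjoint l.toFinset (insert v Z))) := by
            refine avg_mono fun l _ => ind_le_add fun h => ?_
            by_contra hcon
            push Not at hcon
            obtain ⟨h1, h2, h3⟩ := hcon
            rw [Finset.disjoint_insert_right] at h3
            apply h
            refine ⟨List.nodup_cons.2 ⟨by simpa using h3.1, h2⟩, ?_⟩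
            rw [List.toFinset_cons, Finset.disjoint_insert_left]
            exact ⟨h1, h3.2⟩
        _ = ind (v ∈ Z) + avg m fun l => ind (¬ (l.Nodup ∧ Disjoint l.toFinset (insert v Z))) := by
            rw [avg_add, avg_const]
        _ ≤ _ := by
            gcongr
            refine (ih _).trans ?_
            gcongr
            exact_mod_cast Finset.card_insert_le v Z
    rcases isEmpty_or_nonempty V with hV | hV
    · simp [avg, av]
    calc _ ≤ av fun v : V => ind (v ∈ Z) +
          (m : ℝ) * (m + (Z.card + 1)) / (Fintype.card V : ℝ) := av_mono key
      _ = (Z.card + (m : ℝ) * (m + (Z.card + 1))) / (Fintype.card V : ℝ) := by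
          rw [av_add, av_const, av_ind]
          simp [add_div]
      _ ≤ _ := by
          gcongr
          push_cast
          nlinarith [(Nat.cast_nonneg m : (0 : ℝ) ≤ m), (Nat.cast_nonneg Z.card : (0 : ℝ) ≤ Z.card)]

end Averages

section Cliques

variable {V : Type*} [DecidableEq V]

/-- `A` spans a complete `k`-graph in the `k`-graph with edge set `E`. -/
def IsClq (k : ℕ) (E : Finset (Finset V)) (A : Finset V) : Prop :=
  ∀ e ⊆ A, e.card = k → e ∈ E

/-- The vertices of the list `l` span a complete `k`-graph. -/
def LClq (k : ℕ) (E : Finset (Finset V)) (l : List V) : Prop := IsClq k E l.toFinset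

theorem IsClq.mono {V : Type*} {k : ℕ} {E : Finset (Finset V)} {A B : Finset V} (h : IsClq k E B)
    (hAB : A ⊆ B) : IsClq k E A :=
  fun e he => h e (he.trans hAB)

/-- A clique is extended by every vertex forming an edge with all of its `(k-1)`-subsets. -/
theorem IsClq.insert {k : ℕ} {E : Finset (Finset V)} {A : Finset V} {v : V} (hA : IsClq k E A)
    (h : ∀ T ∈ A.powersetCard (k - 1), insert v T ∈ E) : IsClq k E (insert v A) := by
  intro e he hek
  by_cases hv : v ∈ e
  · have := h (e.erase v) (by
      rw [mem_powersetCard, card_erase_of_mem hv, hek]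
      exact ⟨by rwa [← Finset.subset_insert_iff], rfl⟩)
    rwa [insert_erase hv] at this
  · exact hA e ((Finset.subset_insert_iff_of_notMem hv).1 he) hek

theorem isClq_of_card_lt {k : ℕ} {E : Finset (Finset V)} {A : Finset V} (h : A.card < k) :
    IsClq k E A := fun e he hek => by
  have := card_le_card he
  omega

/-- The vertex sets that can be tiled by copies of `K_t^k`. -/
inductive Tiled (k t : ℕ) (E : Finset (Finset V)) : Finset V → Prop
  | empty : Tiled k t E ∅
  | cons (A S : Finset V) : A.card = t → IsClq k E A → Disjoint A S → Tiled k t E S →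
      Tiled k t E (A ∪ S)

variable {k t : ℕ} {E : Finset (Finset V)}

theorem Tiled.of_clique {A : Finset V} (h : A.card = t) (hA : IsClq k E A) : Tiled k t E A := by
  simpa using Tiled.cons A ∅ h hA (disjoint_empty_right A) Tiled.empty

theorem Tiled.union {S T : Finset V} (hS : Tiled k t E S) (hT : Tiled k t E T)
    (h : Disjoint S T) : Tiled k t E (S ∪ T) := by
  induction hS with
  | empty => simpa using hT
  | cons A S hA hc hd _ ih =>
    rw [disjoint_union_left] at h
    rw [union_assoc]
    exact Tiled.cons A _ hA hc (disjoint_union_right.2 ⟨hd, h.1⟩) (ih h.2)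

theorem Tiled.dvd_card {S : Finset V} (hS : Tiled k t E S) : t ∣ S.card := by
  induction hS with
  | empty => simp
  | cons A S hA hc hd _ ih =>
    rw [card_union_of_disjoint hd, hA]
    exact dvd_add (dvd_refl t) ih

theorem Tiled.biUnion {ι : Type*} [DecidableEq ι] (s : Finset ι) (f : ι → Finset V)
    (hf : ∀ i ∈ s, Tiled k t E (f i)) (hd : (s : Set ι).PairwiseDisjoint f) :
    Tiled k t E (s.biUnion f) := by
  induction s using Finset.induction_on with
  | empty => simpa using Tiled.empty
  | insert a s ha ih =>
    rw [biUnion_insert]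
    refine (hf a (mem_insert_self a s)).union
      (ih (fun i hi => hf i (mem_insert_of_mem hi)) (hd.subset (by simp))) ?_
    rw [disjoint_biUnion_right]
    intro i hi
    exact hd (by simp) (by simp [hi]) (by rintro rfl; exact ha hi)

/-- The list `l` connects the lists `X` and `Y`: unless vertices are repeated, both `X` and `Y`
together with `l` can be tiled. -/
def Conn (k t : ℕ) (E : Finset (Finset V)) (X Y l : List V) : Prop :=
  (X ++ l).Nodup → (Y ++ l).Nodup →
    Tiled k t E (X ++ l).toFinset ∧ Tiled k t E (Y ++ l).toFinset

theorem disjoint_toFinset_of_nodup {l l' : List V} (h : (l ++ l').Nodup) :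
    Disjoint l.toFinset l'.toFinset := by
  rw [List.disjoint_toFinset_iff_disjoint]
  exact (List.nodup_append'.1 h).2.2

theorem Tiled.append {l l' : List V} (hl : Tiled k t E l.toFinset) (hl' : Tiled k t E l'.toFinset)
    (h : (l ++ l').Nodup) : Tiled k t E (l ++ l').toFinset := by
  rw [List.toFinset_append]
  exact hl.union hl' (disjoint_toFinset_of_nodup h)

theorem Tiled.of_perm {l l' : List V} (hl : Tiled k t E l.toFinset) (h : l.Perm l') :
    Tiled k t E l'.toFinset := by
  rwa [← List.toFinset_eq_of_perm _ _ h]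

theorem Tiled.of_list {l : List V} (h : l.length = t) (hl : LClq k E l) (hn : l.Nodup) :
    Tiled k t E l.toFinset :=
  Tiled.of_clique (by rw [List.toFinset_card_of_nodup hn, h]) hl

theorem Tiled.of_append_perm {a b c : List V} (ha : Tiled k t E a.toFinset)
    (hb : Tiled k t E b.toFinset) (hc : c.Nodup) (h : (a ++ b).Perm c) :
    Tiled k t E c.toFinset :=
  (ha.append hb (h.nodup_iff.2 hc)).of_perm h

theorem Conn.trans {X Y Z l l' : List V} (h : Conn k t E X Z l) (h' : Conn k t E Z Y l') :
    Conn k t E X Y (l ++ (Z ++ l')) := by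
  intro hX hY
  have p1 : ((X ++ l) ++ (Z ++ l')).Perm (X ++ (l ++ (Z ++ l'))) := by simp
  have p2 : ((Y ++ l') ++ (Z ++ l)).Perm (Y ++ (l ++ (Z ++ l'))) := by
    rw [List.perm_iff_count]
    intro a
    simp only [List.count_append]
    omega
  have n1 := p1.nodup_iff.2 hX
  have n2 := p2.nodup_iff.2 hY
  have := h (List.nodup_append'.1 n1).1 (List.nodup_append'.1 n2).2.1
  have := h' (List.nodup_append'.1 n1).2.1 (List.nodup_append'.1 n2).1
  exact ⟨Tiled.of_append_perm (by tauto) (by tauto) hX p1,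
    Tiled.of_append_perm (by tauto) (by tauto) hY p2⟩

theorem Conn.append {X Y X' Y' l l' : List V} (h : Conn k t E X Y l) (h' : Conn k t E X' Y' l') :
    Conn k t E (X ++ X') (Y ++ Y') (l ++ l') := by
  intro hX hY
  have p : ∀ X X' : List V, ((X ++ l) ++ (X' ++ l')).Perm ((X ++ X') ++ (l ++ l')) := by
    intro X X'
    rw [List.perm_iff_count]
    intro a
    simp only [List.count_append]
    omega
  have n1 := (p X X').nodup_iff.2 hX
  have n2 := (p Y Y').nodup_iff.2 hY
  have := h (List.nodup_append'.1 n1).1 (List.nodup_append'.1 n2).1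
  have := h' (List.nodup_append'.1 n1).2.1 (List.nodup_append'.1 n2).2.1
  exact ⟨Tiled.of_append_perm (by tauto) (by tauto) hX (p X X'),
    Tiled.of_append_perm (by tauto) (by tauto) hY (p Y Y')⟩

theorem Conn.of_cliques {x y : V} {l : List V} (hl : l.length + 1 = t) (hx : LClq k E (x :: l))
    (hy : LClq k E (y :: l)) : Conn k t E [x] [y] l := fun h h' =>
  ⟨Tiled.of_list (by simpa using hl) hx h, Tiled.of_list (by simpa using hl) hy h'⟩

theorem Conn.pad {X Y l q : List V} (h : Conn k t E X Y l) (hq : q.length = t)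
    (hc : LClq k E q) : Conn k t E X Y (l ++ q) := by
  have : Conn k t E [] [] q := fun h _ => ⟨Tiled.of_list hq hc h, Tiled.of_list hq hc h⟩
  simpa using h.append this

variable [Fintype V]

/-- The proportion of lists of length `m` connecting `X` and `Y`. -/
noncomputable def conn (k t : ℕ) (E : Finset (Finset V)) (m : ℕ) (X Y : List V) : ℝ :=
  avg m fun l => ind (Conn k t E X Y l)

/-- The proportion of lists of length `t - 1` that form cliques both with `x` and with `y`. -/
noncomputable def link (k t : ℕ) (E : Finset (Finset V)) (x y : V) : ℝ :=
  avg (t - 1) fun l => ind (LClq k E (x :: l) ∧ LClq k E (y :: l))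

/-- The proportion of lists of length `m` forming cliques. -/
noncomputable def clqDens (k : ℕ) (E : Finset (Finset V)) (m : ℕ) : ℝ :=
  avg m fun l => ind (LClq k E l)

theorem link_nonneg (x y : V) : 0 ≤ link k t E x y := avg_nonneg fun _ => ind_nonneg _

theorem conn_nonneg (m : ℕ) (X Y : List V) : 0 ≤ conn k t E m X Y :=
  avg_nonneg fun _ => ind_nonneg _

theorem link_comm (x y : V) : link k t E x y = link k t E y x := by
  simp only [link, and_comm]

theorem link_le_conn (ht : 0 < t) (x y : V) : link k t E x y ≤ conn k t E (t - 1) [x] [y] :=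
  avg_mono fun l hl => ind_mono fun h => Conn.of_cliques (by omega) h.1 h.2

theorem conn_trans (ht : 0 < t) (m : ℕ) (x y : V) :
    (av fun z => conn k t E m [x] [z] * link k t E z y) ≤ conn k t E (m + t) [x] [y] := by
  obtain ⟨s, rfl⟩ : ∃ s, t = s + 1 := ⟨t - 1, by omega⟩
  rw [conn, avg_append]
  simp only [avg]
  rw [avg_av]
  refine av_mono fun z => ?_
  rw [conn, link, ← avg_mul_const]
  refine avg_mono fun l _ => ?_
  rw [← avg_const_mul]
  refine avg_mono fun l' hl' => ind_mul fun h h' => ?_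
  exact h.trans (Conn.of_cliques (by omega) h'.1 h'.2)

theorem conn_pad (m : ℕ) (X Y : List V) :
    conn k t E m X Y * clqDens k E t ≤ conn k t E (m + t) X Y := by
  rw [conn, conn, avg_append, ← avg_mul_const]
  refine avg_mono fun l _ => ?_
  rw [clqDens, ← avg_const_mul]
  exact avg_mono fun q hq => ind_mul fun h h' => h.pad hq h'

theorem conn_append (m m' : ℕ) (X Y X' Y' : List V) :
    conn k t E m X Y * conn k t E m' X' Y' ≤ conn k t E (m + m') (X ++ X') (Y ++ Y') := by
  rw [conn, conn, conn, avg_append, ← avg_mul_const]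
  refine avg_mono fun l _ => ?_
  rw [← avg_const_mul]
  exact avg_mono fun q hq => ind_mul fun h h' => h.append h'

theorem conn_pow_le {m : ℕ} {η : ℝ} (hη : 0 ≤ η) (h : ∀ x y : V, η ≤ conn k t E m [x] [y])
    (X Y : List V) (hXY : X.length = Y.length) :
    η ^ X.length ≤ conn k t E (X.length * m) X Y := by
  induction X generalizing Y with
  | nil =>
    obtain rfl : Y = [] := List.length_eq_zero_iff.1 hXY.symm
    simp [conn, avg, Conn, ind, Tiled.empty]
  | cons x X ih =>
    obtain ⟨y, Y, rfl⟩ : ∃ y Y', Y = y :: Y' := List.exists_cons_of_length_eq_add_one hXY.symm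
    have hX := ih Y (by simpa using hXY)
    calc η ^ (x :: X).length = η * η ^ X.length := by rw [List.length_cons, pow_succ']
      _ ≤ conn k t E m [x] [y] * conn k t E (X.length * m) X Y :=
          mul_le_mul (h x y) hX (pow_nonneg hη _) (conn_nonneg _ _ _)
      _ ≤ conn k t E (m + X.length * m) ([x] ++ X) ([y] ++ Y) := conn_append _ _ _ _ _ _
      _ = _ := by
          simp only [List.length_cons, add_mul, one_mul, List.singleton_append]
          rw [add_comm]

/-- The list `L` absorbs the list `Q`. -/
def AbsorbedBy (k t : ℕ) (E : Finset (Finset V)) (Q L : List V) : Prop :=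
  Tiled k t E L.toFinset ∧ Tiled k t E (Q ++ L).toFinset

theorem absorbs_dens {m : ℕ} {η : ℝ} (hη : 0 ≤ η) (h : ∀ x y : V, η ≤ conn k t E m [x] [y])
    (Q : List V) (hQ : Q.length = t) :
    η ^ t * clqDens k E t ≤
      avg (t * m + t) fun L => ind ((Q ++ L).Nodup → AbsorbedBy k t E Q L) := by
  rw [avg_append, avg_comm, clqDens, ← avg_const_mul]
  refine avg_mono fun Y hY => ?_
  have hc := conn_pow_le hη h Q Y (hQ.trans hY.symm)
  rw [hQ] at hc
  calc _ ≤ conn k t E (t * m) Q Y * ind (LClq k E Y) := by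
        gcongr
        exact ind_nonneg _
    _ = _ := (avg_mul_const _ _ _).symm
    _ ≤ _ := by
        refine avg_mono fun l _ => ind_mul fun h h' hn => ?_
        have p : (Y ++ l).Perm (l ++ Y) := List.perm_append_comm
        have n := List.nodup_append'.1 hn
        have hY' : Tiled k t E Y.toFinset := Tiled.of_list hY h' (List.nodup_append'.1 n.2.1).2.1
        have p2 : ((Q ++ l) ++ Y).Perm (Q ++ (l ++ Y)) := by simp
        have n2 := p2.nodup_iff.2 hn
        obtain ⟨h1, h2⟩ := h (List.nodup_append'.1 n2).1 (p.nodup_iff.2 n.2.1)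
        exact ⟨h2.of_perm p, Tiled.of_append_perm h1 hY' hn p2⟩

end Cliques

section Absorption

variable {V : Type*} [DecidableEq V] [Fintype V] {k t : ℕ} {E : Finset (Finset V)}

/-- A single absorber, avoiding a prescribed small set, that works for a positive proportion of a
given family of `t`-sets. -/
theorem exists_absorber [Nonempty V] {M : ℕ} {a : ℝ} (ha : 0 < a)
    (habs : ∀ Q : List V, Q.length = t →
      a ≤ avg M fun L => ind ((Q ++ L).Nodup → AbsorbedBy k t E Q L))
    (Z : Finset V) (hZ : (M : ℝ) * (M + Z.card + t) ≤ a / 2 * Fintype.card V)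
    (F : Finset (Finset V)) (hF : ∀ Q ∈ F, Q.card = t) (hne : F.Nonempty) :
    ∃ U : Finset V, U.card ≤ M ∧ Disjoint U Z ∧ Tiled k t E U ∧
      ∃ F' ⊆ F, (F'.card : ℝ) ≤ (1 - a / 2) * F.card ∧
        ∀ Q ∈ F, Q ∉ F' → Disjoint Q U ∧ Tiled k t E (Q ∪ U) := by
  classical
  let good : Finset V → List V → Prop := fun Q L =>
    Disjoint L.toFinset Z ∧ Tiled k t E L.toFinset ∧ Disjoint Q L.toFinset ∧
      Tiled k t E (Q ∪ L.toFinset)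
  have hV : (0 : ℝ) < Fintype.card V := by exact_mod_cast Fintype.card_pos
  have hgood : ∀ Q ∈ F, a / 2 ≤ avg M fun L => ind (good Q L) := by
    intro Q hQ
    have h1 : a ≤ avg M fun L => ind (¬ (L.Nodup ∧ Disjoint L.toFinset (Z ∪ Q))) +
        ind (good Q L) := by
      refine (habs Q.toList (by simpa using hF Q hQ)).trans (avg_mono fun L _ => ind_le_add ?_)
      intro h
      by_cases hd : L.Nodup ∧ Disjoint L.toFinset (Z ∪ Q)
      · refine Or.inr ?_
        rw [disjoint_union_right] at hd
        have hn : (Q.toList ++ L).Nodup := by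
          rw [List.nodup_append']
          refine ⟨Q.nodup_toList, hd.1, ?_⟩
          rw [← List.disjoint_toFinset_iff_disjoint, toList_toFinset]
          exact hd.2.2.symm
        have := h hn
        rw [AbsorbedBy, List.toFinset_append, toList_toFinset] at this
        exact ⟨hd.2.1, this.1, hd.2.2.symm, this.2⟩
      · exact Or.inl hd
    rw [avg_add] at h1
    have h2 := avg_degenerate M (Z ∪ Q)
    have h3 : (M : ℝ) * (M + (Z ∪ Q).card) / Fintype.card V ≤ a / 2 := by
      rw [div_le_iff₀ hV]
      refine le_trans ?_ hZ
      rw [add_assoc]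
      gcongr
      have := card_union_le Z Q
      rw [hF Q hQ] at this
      exact_mod_cast this
    linarith
  obtain ⟨L, hL, hle⟩ := exists_avg_le M fun L => ∑ Q ∈ F, ind (good Q L)
  rw [avg_sum] at hle
  have hsum : a / 2 * F.card ≤ ((F.filter fun Q => good Q L).card : ℝ) := by
    rw [← sum_ind]
    refine le_trans ?_ hle
    rw [mul_comm, ← nsmul_eq_mul]
    exact Finset.card_nsmul_le_sum _ _ _ hgood
  have hFpos : (0 : ℝ) < F.card := by exact_mod_cast hne.card_pos
  have hpos : 0 < (F.filter fun Q => good Q L).card := by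
    have : (0 : ℝ) < ((F.filter fun Q => good Q L).card : ℝ) := lt_of_lt_of_le (by positivity) hsum
    exact_mod_cast this
  obtain ⟨Q₀, hQ₀⟩ := card_pos.1 hpos
  have hg := (mem_filter.1 hQ₀).2
  refine ⟨L.toFinset, hL ▸ L.toFinset_card_le, hg.1, hg.2.1, F.filter fun Q => ¬ good Q L,
    filter_subset _ _, ?_, ?_⟩
  · have := card_filter_add_card_filter_not (s := F) fun Q => good Q L
    have : ((F.filter fun Q => good Q L).card : ℝ) + (F.filter fun Q => ¬ good Q L).card =
        F.card := by exact_mod_cast this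
    linarith
  · intro Q hQ hQ'
    have : good Q L := by
      by_contra hcon
      exact hQ' (mem_filter.2 ⟨hQ, hcon⟩)
    exact this.2.2

/-- After `r` steps, the set of absorbers constructed greedily can absorb all but an
exponentially small proportion of all `t`-sets. -/
theorem exists_partial_absorber [Nonempty V] {M : ℕ} {a : ℝ} (ha : 0 < a) (ha' : a ≤ 1)
    (habs : ∀ Q : List V, Q.length = t →
      a ≤ avg M fun L => ind ((Q ++ L).Nodup → AbsorbedBy k t E Q L))
    (Z : Finset V) (r : ℕ)
    (hZ : (M : ℝ) * (M + (Z.card + r * M) + t) ≤ a / 2 * Fintype.card V) :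
    ∃ U : Finset V, U.card ≤ r * M ∧ Disjoint U Z ∧ Tiled k t E U ∧
      ∃ F : Finset (Finset V), (∀ Q ∈ F, Q.card = t) ∧
        (F.card : ℝ) ≤ (1 - a / 2) ^ r * (Fintype.card V : ℝ) ^ t ∧
        ∀ Q : Finset V, Q.card = t → Q ∉ F → Disjoint Q U → Tiled k t E (Q ∪ U) := by
  induction r with
  | zero =>
    refine ⟨∅, by simp, by simp, Tiled.empty, powersetCard t univ, fun Q hQ =>
      (mem_powersetCard.1 hQ).2, ?_, fun Q hQ hQ' => absurd (by simpa using hQ) hQ'⟩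
    rw [card_powersetCard, pow_zero, one_mul, card_univ]
    exact_mod_cast Nat.choose_le_pow _ _
  | succ r ih =>
    obtain ⟨U, hU, hUZ, hUt, F, hF, hFc, hQ⟩ := ih (le_trans (by gcongr; simp) hZ)
    rcases F.eq_empty_or_nonempty with rfl | hne
    · refine ⟨U, hU.trans (by gcongr; simp), hUZ, hUt, ∅, by simp, ?_, hQ⟩
      have : 0 ≤ 1 - a / 2 := by linarith
      simp only [card_empty, Nat.cast_zero]
      positivity
    obtain ⟨U', hU', hUZ', hUt', F', hF', hFc', hQ'⟩ := exists_absorber ha habs (U ∪ Z) (by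
      refine le_trans ?_ hZ
      gcongr
      have h1 : ((U ∪ Z).card : ℝ) ≤ U.card + Z.card := by exact_mod_cast card_union_le U Z
      have h2 : (U.card : ℝ) ≤ r * M := by exact_mod_cast hU
      push_cast
      nlinarith [(Nat.cast_nonneg M : (0 : ℝ) ≤ M)]) F hF hne
    rw [disjoint_union_right] at hUZ'
    refine ⟨U ∪ U', ?_, disjoint_union_left.2 ⟨hUZ, hUZ'.2⟩, hUt.union hUt' hUZ'.1.symm, F',
      fun Q hQ => hF Q (hF' hQ), ?_, ?_⟩
    · have := card_union_le U U'
      rw [add_mul]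
      omega
    · rw [pow_succ', mul_assoc]
      refine hFc'.trans ?_
      have : 0 ≤ 1 - a / 2 := by linarith
      gcongr
    · intro Q hQc hQF hQd
      rw [disjoint_union_right] at hQd
      by_cases h : Q ∈ F
      · have := (hQ' Q h hQF).2
        rw [union_comm U, ← union_assoc]
        exact this.union hUt (disjoint_union_left.2 ⟨hQd.1, hUZ'.1⟩)
      · rw [← union_assoc]
        exact (hQ Q hQc h hQd.1).union hUt' (disjoint_union_left.2 ⟨hQd.2, hUZ'.1.symm⟩)

/-- There is a small set that can absorb any set of at most `w * t` vertices whose size is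
divisible by `t`. -/
theorem exists_absorbing_set [Nonempty V] {M : ℕ} {a : ℝ} (ha : 0 < a) (ha' : a ≤ 1)
    (habs : ∀ Q : List V, Q.length = t →
      a ≤ avg M fun L => ind ((Q ++ L).Nodup → AbsorbedBy k t E Q L))
    (r w : ℕ) (hw : (M : ℝ) * (M + w * (r * M) + t) ≤ a / 2 * Fintype.card V)
    (hr : (1 - a / 2) ^ r * (Fintype.card V : ℝ) ^ t < 1) :
    ∃ U : Finset V, U.card ≤ w * (r * M) ∧ Tiled k t E U ∧
      ∀ j ≤ w, ∀ W : Finset V, W.card = j * t → Disjoint W U → Tiled k t E (W ∪ U) := by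
  induction w with
  | zero =>
    refine ⟨∅, by simp, Tiled.empty, fun j hj W hW _ => ?_⟩
    obtain rfl : j = 0 := by omega
    obtain rfl : W = ∅ := by simpa using hW
    simpa using Tiled.empty
  | succ w ih =>
    obtain ⟨U, hU, hUt, hUa⟩ := ih (le_trans (by gcongr; simp) hw)
    obtain ⟨U', hU', hUU', hUt', F, hF, hFc, hQ⟩ := exists_partial_absorber ha ha' habs U r (by
      refine le_trans ?_ hw
      gcongr
      have : (U.card : ℝ) ≤ w * (r * M) := by exact_mod_cast hU
      push_cast
      linarith)
    have hF0 : F = ∅ := by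
      have : (F.card : ℝ) < 1 := hFc.trans_lt hr
      have : F.card < 1 := by exact_mod_cast this
      exact card_eq_zero.1 (by omega)
    subst hF0
    refine ⟨U ∪ U', ?_, hUt.union hUt' hUU'.symm, ?_⟩
    · have := card_union_le U U'
      rw [add_mul]
      omega
    · intro j hj W hW hWd
      rw [disjoint_union_right] at hWd
      cases j with
      | zero =>
        obtain rfl : W = ∅ := by simpa using hW
        simpa using hUt.union hUt' hUU'.symm
      | succ j =>
        obtain ⟨Q, hQW, hQc⟩ := exists_subset_card_eq (s := W) (n := t) (by rw [hW, add_mul]; omega)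
        have h1 := hUa j (by omega) (W \ Q) (by
          rw [card_sdiff_of_subset hQW, hW, hQc, add_mul]
          omega) (hWd.1.mono_left sdiff_subset)
        have h2 := hQ Q hQc (by simp) (hWd.2.mono_left hQW)
        have h3 := h1.union h2 (by
          rw [disjoint_union_left, disjoint_union_right, disjoint_union_right]
          exact ⟨⟨sdiff_disjoint, hWd.2.mono_left sdiff_subset⟩,
            (hWd.1.mono_left hQW).symm, hUU'.symm⟩)
        have h4 : W \ Q ∪ U ∪ (Q ∪ U') = W ∪ (U ∪ U') := by
          rw [union_union_union_comm, sdiff_union_of_subset hQW]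
        rwa [h4] at h3

/-- The numerical conditions of `exists_absorbing_set` hold for all large vertex sets. -/
theorem exists_absorber_count {a ε : ℝ} (ha : 0 < a) (ha' : a ≤ 1) (hε : 0 < ε) (M t w : ℕ) :
    ∃ n₀ : ℕ, ∀ n : ℕ, n₀ ≤ n → ∃ r : ℕ,
      (M : ℝ) * (M + w * (r * M) + t) ≤ a / 2 * n ∧ (1 - a / 2) ^ r * (n : ℝ) ^ t < 1 ∧
      (w * (r * M) : ℝ) ≤ ε * n := by
  have hq : |1 - a / 2| < 1 := by
    rw [abs_lt]
    constructor <;> linarith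
  have hq0 : 0 < 1 - a / 2 := by linarith
  have h1 := (tendsto_pow_const_mul_const_pow_of_abs_lt_one (2 * t) hq).eventually
    (gt_mem_nhds hq0)
  obtain ⟨s₁, hs₁⟩ := Filter.eventually_atTop.1 h1
  obtain ⟨s₂, hs₂⟩ := exists_nat_ge ((M : ℝ) * (M + w * M + t) / (a / 2))
  obtain ⟨s₃, hs₃⟩ := exists_nat_ge ((w * M : ℝ) / ε)
  refine ⟨(s₁ + s₂ + s₃ + 1) ^ 2, fun n hn => ⟨n.sqrt, ?_⟩⟩
  have hs : s₁ + s₂ + s₃ + 1 ≤ n.sqrt := Nat.le_sqrt'.2 hn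
  have hsq : n.sqrt * n.sqrt ≤ n := Nat.sqrt_le n
  have hsq' : n < (n.sqrt + 1) ^ 2 := Nat.lt_succ_sqrt' n
  set s := n.sqrt
  have hsq1 : (s : ℝ) * s ≤ n := by exact_mod_cast hsq
  have hs1 : (1 : ℝ) ≤ s := by exact_mod_cast (by omega : 1 ≤ s)
  have hs2 : (s₂ : ℝ) ≤ s := by exact_mod_cast (by omega : s₂ ≤ s)
  have hs3 : (s₃ : ℝ) ≤ s := by exact_mod_cast (by omega : s₃ ≤ s)
  refine ⟨?_, ?_, ?_⟩
  · rw [div_le_iff₀ (by positivity)] at hs₂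
    calc (M : ℝ) * (M + w * (s * M) + t) ≤ M * (M * s + w * (s * M) + t * s) := by
          gcongr
          · nlinarith [(Nat.cast_nonneg M : (0 : ℝ) ≤ M)]
          · nlinarith [(Nat.cast_nonneg t : (0 : ℝ) ≤ t)]
      _ = (M * (M + w * M + t)) * s := by ring
      _ ≤ (s₂ * (a / 2)) * s := by gcongr
      _ ≤ (s * (a / 2)) * s := by gcongr
      _ = a / 2 * (s * s) := by ring
      _ ≤ _ := by gcongr
  · have h := hs₁ (s + 1) (by omega)
    have h2 : (1 - a / 2) ^ s * (n : ℝ) ^ t ≤ (1 - a / 2) ^ s * ((s + 1 : ℕ) : ℝ) ^ (2 * t) := by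
      rw [pow_mul]
      gcongr
      exact_mod_cast hsq'.le
    rw [pow_succ, ← mul_assoc] at h
    have h3 := (mul_lt_iff_lt_one_left hq0).1 h
    linarith
  · rw [div_le_iff₀ hε] at hs₃
    calc (w * (s * M) : ℝ) = (w * M) * s := by ring
      _ ≤ (s₃ * ε) * s := by gcongr
      _ ≤ (s * ε) * s := by gcongr
      _ = ε * (s * s) := by ring
      _ ≤ _ := by gcongr

end Absorption

section AlmostTiling

variable {V : Type*} [DecidableEq V] [Fintype V]

/-- The vertices of `W` coloured `i`. -/
def colorClass (W : Finset V) (c : V → V) (i : V) : Finset V := W.filter fun v => c v = i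

/-- The weight of a colouring, which is larger when the colour classes are less balanced. -/
def weight (t : ℕ) (W : Finset V) (c : V → V) : ℕ :=
  ∑ i, (2 * t) ^ (t - (colorClass W c i).card)

theorem weight_exchange {t s b m : ℕ} (hs : s < t) (hb : b ≤ t) (hm : 1 ≤ m) (hmb : m ≤ b)
    (h : b + 1 ≤ m + s) :
    (2 * t) ^ (t - b) + m * (2 * t) ^ (t - s) <
      (2 * t) ^ (t - (b - m)) + m * (2 * t) ^ (t - (s + 1)) := by
  have ht : 0 < 2 * t := by omega
  have h1 : 2 * t * (2 * t) ^ (t - b) ≤ (2 * t) ^ (t - (b - m)) := by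
    rw [← pow_succ']
    exact Nat.pow_le_pow_right ht (by omega)
  have h2 : 2 * t * (2 * t) ^ (t - s) ≤ (2 * t) ^ (t - (b - m)) := by
    rw [← pow_succ']
    exact Nat.pow_le_pow_right ht (by omega)
  have h3 : 0 < (2 * t) ^ (t - (s + 1)) := by positivity
  have h4 : 0 < m * (2 * t) ^ (t - (s + 1)) := by positivity
  have h5 : (2 * t) ^ (t - b) ≤ t * (2 * t) ^ (t - b) := Nat.le_mul_of_pos_left _ (by omega)
  have h6 : m * (2 * t) ^ (t - s) ≤ t * (2 * t) ^ (t - s) := Nat.mul_le_mul_right _ (by omega)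
  nlinarith

/-- Moving the vertices of `D` out of one colour class and into distinct other ones. -/
theorem weight_lt_of_recolor {t s : ℕ} {W : Finset V} {c a : V → V} {j : V} {D : Finset V}
    (hs : s < t) (hb : (colorClass W c j).card ≤ t) (hD : D ⊆ colorClass W c j)
    (hne : D.Nonempty) (hcard : (colorClass W c j).card + 1 ≤ D.card + s)
    (ha : Set.InjOn a D) (haj : ∀ v ∈ D, a v ≠ j) (has : ∀ v ∈ D, (colorClass W c (a v)).card = s) :
    let c' : V → V := fun v => if v ∈ D then a v else c v
    (∀ i, colorClass W c' i ⊆ colorClass W c i ∨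
      ∃ v ∈ D, i = a v ∧ colorClass W c' i = insert v (colorClass W c i)) ∧
      weight t W c < weight t W c' := by
  intro c'
  have hDW : ∀ v ∈ D, v ∈ W ∧ c v = j := fun v hv => by
    have := hD hv
    rwa [colorClass, mem_filter] at this
  have h1 : ∀ v ∈ D, colorClass W c' (a v) = insert v (colorClass W c (a v)) := by
    intro v hv
    ext u
    simp only [colorClass, mem_filter, mem_insert, c']
    by_cases hu : u ∈ D
    · simp only [hu, if_true, (hDW u hu).1, true_and, (hDW u hu).2]
      constructor
      · exact fun h => Or.inl (ha hu hv h)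
      · rintro (rfl | h)
        · rfl
        · exact absurd h.symm (haj v hv)
    · simp only [hu, if_false]
      constructor
      · exact Or.inr
      · rintro (rfl | h)
        · exact absurd hv hu
        · exact h
  have h2 : colorClass W c' j = colorClass W c j \ D := by
    ext u
    simp only [colorClass, mem_filter, mem_sdiff, c']
    by_cases hu : u ∈ D
    · simp [hu, haj u hu]
    · simp [hu]
  have h3 : ∀ i, i ≠ j → i ∉ D.image a → colorClass W c' i = colorClass W c i := by
    intro i hij hi
    ext u
    simp only [colorClass, mem_filter, c']
    by_cases hu : u ∈ D
    · have : a u ≠ i := fun h => hi (mem_image.2 ⟨u, hu, h⟩)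
      simp [hu, this, (hDW u hu).2, hij.symm]
    · simp [hu]
  constructor
  · intro i
    by_cases hij : i = j
    · subst hij
      exact Or.inl (h2 ▸ sdiff_subset)
    by_cases hi : i ∈ D.image a
    · obtain ⟨v, hv, rfl⟩ := mem_image.1 hi
      exact Or.inr ⟨v, hv, rfl, h1 v hv⟩
    · exact Or.inl (h3 i hij hi).subset
  · have hj : j ∉ D.image a := by
      intro h
      obtain ⟨v, hv, h⟩ := mem_image.1 h
      exact haj v hv h
    have hsplit : ∀ f : V → ℕ, ∑ i, f i =
        f j + ∑ v ∈ D, f (a v) + ∑ i ∈ univ \ insert j (D.image a), f i := by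
      intro f
      rw [← sum_sdiff (subset_univ (insert j (D.image a))), sum_insert hj, sum_image ha, add_comm]
    unfold weight
    rw [hsplit, hsplit fun i => (2 * t) ^ (t - (colorClass W c' i).card)]
    have e1 : ∑ i ∈ univ \ insert j (D.image a), (2 * t) ^ (t - (colorClass W c' i).card) =
        ∑ i ∈ univ \ insert j (D.image a), (2 * t) ^ (t - (colorClass W c i).card) := by
      refine sum_congr rfl fun i hi => ?_
      rw [mem_sdiff, mem_insert, not_or] at hi
      rw [h3 i hi.2.1 hi.2.2]
    have e2 : ∑ v ∈ D, (2 * t) ^ (t - (colorClass W c (a v)).card) =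
        D.card * (2 * t) ^ (t - s) :=
      sum_const_nat fun v hv => by rw [has v hv]
    have e3 : ∑ v ∈ D, (2 * t) ^ (t - (colorClass W c' (a v)).card) =
        D.card * (2 * t) ^ (t - (s + 1)) := by
      refine sum_const_nat fun v hv => ?_
      rw [h1 v hv, card_insert_of_notMem, has v hv]
      intro h
      rw [colorClass, mem_filter, (hDW v hv).2] at h
      exact haj v hv h.2.symm
    rw [e1, e2, e3, h2, card_sdiff_of_subset hD]
    have := weight_exchange hs hb hne.card_pos (card_le_card hD) hcard
    omega

/-- In a bipartite graph between a set `B` of at most `t` vertices and `t` further vertices with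
more than `(t - s) * |B|` edges there is a matching of size more than `|B| - s`. -/
theorem exists_matching {V : Type*} [DecidableEq V] {t s : ℕ} (hs : s < t) {B : Finset V}
    (hB : B.card ≤ t) (r : V → Fin t → Prop) [∀ v i, Decidable (r v i)]
    (h : (t - s) * B.card < ∑ v ∈ B, (univ.filter fun i => r v i).card) :
    ∃ D ⊆ B, ∃ f : V → Fin t, D.Nonempty ∧ Set.InjOn f D ∧ (∀ v ∈ D, r v (f v)) ∧
      B.card + 1 ≤ D.card + s := by
  have : NeZero t := ⟨by omega⟩
  obtain ⟨e⟩ : Nonempty (B ↪ Fin t) :=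
    Function.Embedding.nonempty_of_card_le (by simpa using hB)
  let g : V → Fin t := fun v => if hv : v ∈ B then e ⟨v, hv⟩ else 0
  have hg : Set.InjOn g B := by
    intro u hu v hv huv
    simp only [g, dif_pos (mem_coe.1 hu), dif_pos (mem_coe.1 hv)] at huv
    simpa using e.injective huv
  have hsum : ∑ v ∈ B, (univ.filter fun i => r v i).card =
      ∑ q : Fin t, (B.filter fun v => r v (g v + q)).card := by
    simp only [card_filter]
    rw [sum_comm (s := univ) (t := B)]
    exact sum_congr rfl fun v _ =>
      (Equiv.sum_comp (Equiv.addLeft (g v)) fun i => if r v i then 1 else 0).symm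
  rw [hsum] at h
  obtain ⟨q, hq⟩ : ∃ q : Fin t, (t - s) * B.card < t * (B.filter fun v => r v (g v + q)).card := by
    by_contra hcon
    push Not at hcon
    have h1 : ∑ q : Fin t, t * (B.filter fun v => r v (g v + q)).card ≤
        ∑ _q : Fin t, (t - s) * B.card := sum_le_sum fun q _ => hcon q
    rw [← mul_sum, sum_const, card_univ, Fintype.card_fin, smul_eq_mul] at h1
    exact absurd (Nat.le_of_mul_le_mul_left h1 (by omega)) (not_le.2 h)
  refine ⟨B.filter fun v => r v (g v + q), filter_subset _ _, fun v => g v + q, ?_, ?_, ?_, ?_⟩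
  · rw [← card_pos]
    by_contra h0
    rw [Nat.eq_zero_of_not_pos h0] at hq
    omega
  · intro u hu v hv huv
    exact hg (filter_subset _ _ hu) (filter_subset _ _ hv) (by simpa using huv)
  · exact fun v hv => (mem_filter.1 hv).2
  · set m := (B.filter fun v => r v (g v + q)).card
    by_contra hcon
    have h1 : m + s ≤ B.card := by omega
    have h2 : t * (m + s) ≤ t * B.card := Nat.mul_le_mul_left _ h1
    obtain ⟨d, rfl⟩ := Nat.exists_eq_add_of_le hs.le
    rw [Nat.add_sub_cancel_left] at hq
    nlinarith

/-- If every clique on `1 ≤ s < t` vertices of `W` has more than `(1 - s / t) * |W|` extensions,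
then all but a bounded number of vertices of `W` can be tiled. -/
theorem exists_almost_tiling {k t : ℕ} (hk : 2 ≤ k) (hkt : k < t) {E : Finset (Finset V)}
    [DecidablePred (IsClq k E)] (W : Finset V)
    (hext : ∀ A ⊆ W, A.Nonempty → A.card < t → IsClq k E A →
      (t - A.card) * W.card + t ^ 3 <
        t * (W.filter fun v => v ∉ A ∧ IsClq k E (insert v A)).card) :
    ∃ S ⊆ W, Tiled k t E S ∧ (W \ S).card ≤ t ^ 3 := by
  classical
  let valid : (V → V) → Prop := fun c =>
    ∀ i, IsClq k E (colorClass W c i) ∧ (colorClass W c i).card ≤ t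
  have hid : valid id := by
    intro i
    have : (colorClass W id i).card ≤ 1 := by
      refine card_le_one.2 fun a ha b hb => ?_
      simp only [colorClass, id, mem_filter] at ha hb
      exact ha.2.trans hb.2.symm
    exact ⟨isClq_of_card_lt (by omega), by omega⟩
  obtain ⟨c, hc, hmax⟩ := exists_max_image (univ.filter valid) (weight t W)
    ⟨id, mem_filter.2 ⟨mem_univ _, hid⟩⟩
  replace hc : valid c := (mem_filter.1 hc).2
  replace hmax : ∀ c', valid c' → weight t W c' ≤ weight t W c := fun c' hc' =>
    hmax c' (mem_filter.2 ⟨mem_univ _, hc'⟩)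
  have hclsW : ∀ i, colorClass W c i ⊆ W := fun i => filter_subset _ _
  have hsumW : ∀ f : V → ℕ, ∑ v ∈ W, f v = ∑ j, ∑ v ∈ colorClass W c j, f v := fun f =>
    (sum_fiberwise W c f).symm
  have hfew : ∀ s, 1 ≤ s → s < t → (univ.filter fun i => (colorClass W c i).card = s).card ≤ t := by
    intro s hs1 hst
    by_contra hcon
    push Not at hcon
    obtain ⟨e⟩ : Nonempty (Fin t ↪ {i // (colorClass W c i).card = s}) :=
      Function.Embedding.nonempty_of_card_le (by
        rw [Fintype.card_fin, Fintype.card_subtype]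
        exact hcon.le)
    let a : Fin t → V := fun q => (e q : V)
    have hainj : Function.Injective a := Subtype.val_injective.comp e.injective
    have has : ∀ q, (colorClass W c (a q)).card = s := fun q => (e q).2
    let r : V → Fin t → Prop := fun v q =>
      v ∉ colorClass W c (a q) ∧ IsClq k E (insert v (colorClass W c (a q)))
    have hlow : t * ((t - s) * W.card + t ^ 3) <
        t * ∑ v ∈ W, (univ.filter fun q => r v q).card := by
      have h1 : ∑ v ∈ W, (univ.filter fun q => r v q).card =
          ∑ q, (W.filter fun v => r v q).card := by
        simp only [card_filter]
        exact sum_comm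
      rw [h1, mul_sum]
      calc t * ((t - s) * W.card + t ^ 3) = ∑ _q : Fin t, ((t - s) * W.card + t ^ 3) := by simp
        _ < _ := by
          refine sum_lt_sum_of_nonempty ⟨⟨0, by omega⟩, mem_univ _⟩ fun q _ => ?_
          have := hext _ (hclsW (a q)) (card_pos.1 (by rw [has]; omega)) (by rw [has]; omega)
            (hc _).1
          rwa [has] at this
    replace hlow := Nat.lt_of_mul_lt_mul_left hlow
    have hcls : ∀ j, j ∉ univ.image a →
        ∑ v ∈ colorClass W c j, (univ.filter fun q => r v q).card ≤
          (t - s) * (colorClass W c j).card := by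
      intro j hj
      by_contra hgt
      push Not at hgt
      obtain ⟨D, hD, f, hne, hinj, hr, hcard⟩ := exists_matching hst (hc j).2 r hgt
      obtain ⟨h1, h2⟩ := weight_lt_of_recolor (a := fun v => a (f v)) hst (hc j).2 hD hne hcard
        (fun u hu v hv huv => hinj hu hv (hainj huv))
        (fun v _ h => hj (mem_image.2 ⟨f v, mem_univ _, h⟩)) (fun v _ => has _)
      refine absurd h2 (not_lt.2 (hmax _ fun i => ?_))
      rcases h1 i with h | ⟨v, hv, rfl, h⟩
      · exact ⟨(hc i).1.mono h, (card_le_card h).trans (hc i).2⟩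
      · rw [h]
        refine ⟨(hr v hv).2, (card_insert_le _ _).trans ?_⟩
        rw [has]
        omega
    have hup : ∑ v ∈ W, (univ.filter fun q => r v q).card ≤ (t - s) * W.card + t ^ 3 := by
      have h2 : W.card = ∑ j, (colorClass W c j).card := by
        rw [card_eq_sum_ones, hsumW]
        simp
      rw [hsumW, h2, mul_sum]
      have h3 : t ^ 3 = ∑ j ∈ univ.image a, t ^ 2 := by
        rw [sum_const, card_image_of_injective _ hainj, card_univ, Fintype.card_fin, smul_eq_mul]
        ring
      rw [h3, ← sum_sdiff (subset_univ (univ.image a)),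
        ← sum_sdiff (subset_univ (univ.image a)) (f := fun j => (t - s) * (colorClass W c j).card)]
      have h4 : ∑ j ∈ univ \ univ.image a,
          ∑ v ∈ colorClass W c j, (univ.filter fun q => r v q).card ≤
            ∑ j ∈ univ \ univ.image a, (t - s) * (colorClass W c j).card :=
        sum_le_sum fun j hj => hcls j (mem_sdiff.1 hj).2
      have h5 : ∑ j ∈ univ.image a, ∑ v ∈ colorClass W c j, (univ.filter fun q => r v q).card ≤
          ∑ j ∈ univ.image a, t ^ 2 := by
        refine sum_le_sum fun j _ => ?_
        calc ∑ v ∈ colorClass W c j, (univ.filter fun q => r v q).card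
            ≤ ∑ v ∈ colorClass W c j, t :=
              sum_le_sum fun v _ => (card_le_univ _).trans_eq (Fintype.card_fin t)
          _ = (colorClass W c j).card * t := by simp
          _ ≤ t * t := Nat.mul_le_mul_right _ (hc j).2
          _ = t ^ 2 := by ring
      omega
    omega
  let I : Finset V := univ.filter fun i => (colorClass W c i).card = t
  refine ⟨I.biUnion (colorClass W c), biUnion_subset.2 fun i _ => hclsW i, ?_, ?_⟩
  · refine Tiled.biUnion _ _ (fun i hi => Tiled.of_clique (mem_filter.1 hi).2 (hc i).1) ?_
    intro i _ j _ hij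
    refine disjoint_left.2 fun v hv hv' => hij ?_
    simp only [colorClass, mem_filter] at hv hv'
    exact hv.2.symm.trans hv'.2
  · have hsub : W \ I.biUnion (colorClass W c) ⊆ (range t).biUnion fun s =>
        (univ.filter fun i => 1 ≤ s ∧ (colorClass W c i).card = s).biUnion (colorClass W c) := by
      intro v hv
      rw [mem_sdiff, mem_biUnion] at hv
      have hvc : v ∈ colorClass W c (c v) := mem_filter.2 ⟨hv.1, rfl⟩
      have hlt : (colorClass W c (c v)).card < t := lt_of_le_of_ne (hc _).2 fun h =>
        hv.2 ⟨c v, mem_filter.2 ⟨mem_univ _, h⟩, hvc⟩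
      simp only [mem_biUnion, mem_range, mem_filter, mem_univ, true_and]
      exact ⟨_, hlt, c v, ⟨card_pos.2 ⟨v, hvc⟩, rfl⟩, hvc⟩
    calc (W \ I.biUnion (colorClass W c)).card ≤ (range t).card * (t * t) := by
          refine (card_le_card hsub).trans (card_biUnion_le_card_mul _ _ _ fun s hs => ?_)
          refine (card_biUnion_le_card_mul _ _ t fun i _ => (hc i).2).trans ?_
          refine Nat.mul_le_mul_right _ ?_
          by_cases h1 : 1 ≤ s
          · simpa [h1] using hfew s h1 (mem_range.1 hs)
          · simp [h1]
      _ = t ^ 3 := by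
          rw [card_range]
          ring

end AlmostTiling

section Links

variable {V : Type*} [DecidableEq V] [Fintype V] {k t : ℕ} {E : Finset (Finset V)} {α : ℝ}

/-- Few vertices with a given property fail to extend a given clique. -/
theorem clique_extension (hα : 0 ≤ α)
    (hE : ∀ T : Finset V, T.card = k - 1 → av (fun v => ind (insert v T ∉ E)) ≤ α)
    {l : List V} {s : ℕ} (hl : l.length ≤ s) (hc : LClq k E l) (p : V → Prop) :
    av (fun v => ind (p v)) - α * (s.choose (k - 1) : ℝ) ≤
      av fun v => ind (p v ∧ LClq k E (v :: l)) := by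
  have h1 : av (fun v => ind (p v)) ≤ av fun v => ind (p v ∧ LClq k E (v :: l)) +
      ∑ T ∈ l.toFinset.powersetCard (k - 1), ind (insert v T ∉ E) := by
    refine av_mono fun v => ?_
    by_cases h : ∀ T ∈ l.toFinset.powersetCard (k - 1), insert v T ∈ E
    · have h2 : LClq k E (v :: l) := by
        rw [LClq, List.toFinset_cons]
        exact IsClq.insert hc h
      refine (ind_mono fun hp => ⟨hp, h2⟩).trans (le_add_of_nonneg_right ?_)
      exact sum_nonneg fun T _ => ind_nonneg _
    · push Not at h
      obtain ⟨T, hT, hv⟩ := h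
      refine (ind_le_one _).trans ?_
      rw [← ind_true hv]
      refine le_trans ?_ (le_add_of_nonneg_left (ind_nonneg _))
      exact single_le_sum (f := fun T => ind (insert v T ∉ E)) (fun T _ => ind_nonneg _) hT
  have h2 : (av fun v => ∑ T ∈ l.toFinset.powersetCard (k - 1), ind (insert v T ∉ E)) ≤
      α * (s.choose (k - 1) : ℝ) := by
    have h3 : (av fun v => ∑ T ∈ l.toFinset.powersetCard (k - 1), ind (insert v T ∉ E)) =
        ∑ T ∈ l.toFinset.powersetCard (k - 1), av fun v => ind (insert v T ∉ E) := by
      unfold av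
      rw [sum_comm, sum_div]
    rw [h3]
    calc _ ≤ ∑ T ∈ l.toFinset.powersetCard (k - 1), α :=
          sum_le_sum fun T hT => hE T (mem_powersetCard.1 hT).2
      _ = α * (l.toFinset.card.choose (k - 1) : ℝ) := by
          rw [sum_const, card_powersetCard, nsmul_eq_mul, mul_comm]
      _ ≤ _ := by
          gcongr
          exact_mod_cast l.toFinset_card_le.trans hl
  rw [av_add] at h1
  linarith

theorem clique_extension_univ [Nonempty V] (hα : 0 ≤ α)
    (hE : ∀ T : Finset V, T.card = k - 1 → av (fun v => ind (insert v T ∉ E)) ≤ α)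
    {l : List V} {s : ℕ} (hl : l.length ≤ s) (hc : LClq k E l) :
    1 - α * (s.choose (k - 1) : ℝ) ≤ av fun v => ind (LClq k E (v :: l)) := by
  have := clique_extension hα hE hl hc fun _ => True
  simpa only [ind_true trivial, av_const, true_and] using this

theorem clqDens_ge [Nonempty V] (hk : 0 < k) (hα : 0 ≤ α)
    (hE : ∀ T : Finset V, T.card = k - 1 → av (fun v => ind (insert v T ∉ E)) ≤ α)
    (he : 0 ≤ 1 - α * ((t - 1).choose (k - 1) : ℝ)) :
    (1 - α * ((t - 1).choose (k - 1) : ℝ)) ^ t ≤ clqDens k E t := by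
  have := avg_succ_iter (m := 0) (j := t) (P := LClq k E) (p := 1) he
    (by simp only [avg]; rw [ind_true (show LClq k E [] from isClq_of_card_lt (by simpa using hk))])
    (fun l hl hc => clique_extension_univ hα hE (by omega) hc)
  simpa [clqDens] using this

theorem link_degree [Nonempty V] (hk : 2 ≤ k) (hα : 0 ≤ α)
    (hE : ∀ T : Finset V, T.card = k - 1 → av (fun v => ind (insert v T ∉ E)) ≤ α)
    {e σ : ℝ} (he : e = 1 - α * ((t - 1).choose (k - 1) : ℝ)) (he0 : 0 < e) (hσ : 0 ≤ σ) (x : V) :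
    e - σ ≤ av fun y => ind (σ * e ^ (t - 1) ≤ link k t E x y) := by
  set p := avg (t - 1) fun l => ind (LClq k E (x :: l)) with hp
  have hp0 : e ^ (t - 1) ≤ p := by
    have := avg_succ_iter (m := 0) (j := t - 1) (P := fun l => LClq k E (x :: l)) (p := 1) he0.le
      (by simp only [avg]; rw [ind_true (show LClq k E [x] from isClq_of_card_lt (by simp; omega))])
      (fun l hl hc => by
        rw [he]
        refine (clique_extension_univ hα hE (s := t - 1) (by simp; omega) hc).trans ?_
        refine av_mono fun v => ind_mono fun h => ?_
        rw [LClq] at h ⊢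
        rwa [List.toFinset_eq_of_perm _ _ (List.Perm.swap v x l)])
    simpa using this
  have hpos : 0 < p := lt_of_lt_of_le (by positivity) hp0
  have h1 : e * p ≤ av (link k t E x) := by
    unfold link
    rw [← avg_av, hp, ← avg_const_mul]
    refine avg_mono fun l hl => ?_
    by_cases h : LClq k E (x :: l)
    · rw [ind_true h, mul_one, he]
      have hl' : LClq k E l := IsClq.mono h (by rw [List.toFinset_cons]; exact subset_insert _ _)
      exact (clique_extension_univ hα hE hl.le hl').trans
        (av_mono fun v => ind_mono fun hv => ⟨h, hv⟩)
    · rw [ind_false h, mul_zero]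
      exact av_nonneg fun v => ind_nonneg _
  have h2 := av_ind_ge (f := link k t E x) (a := σ * p) (b := p) (by positivity)
    fun y => avg_mono fun l _ => ind_mono fun h => h.1
  have h3 : av (fun y => ind (σ * p ≤ link k t E x y)) ≤
      av fun y => ind (σ * e ^ (t - 1) ≤ link k t E x y) :=
    av_mono fun y => ind_mono fun h => le_trans (by gcongr) h
  refine le_trans ?_ h3
  have h4 : p * (e - σ) ≤ p * av (fun y => ind (σ * p ≤ link k t E x y)) := by linarith
  exact le_of_mul_le_mul_left h4 hpos

theorem link_le_one [Nonempty V] (x y : V) : link k t E x y ≤ 1 :=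
  (avg_mono fun _ _ => ind_le_one _).trans (avg_const _ _).le

/-- The density of the links between `X` and its complement. -/
noncomputable def cross (k t : ℕ) (E : Finset (Finset V)) (X : Finset V) : ℝ :=
  av fun v => av fun u => ind (u ∈ X ∧ v ∉ X) * link k t E u v

theorem cross_compl (X : Finset V) : cross k t E Xᶜ = cross k t E X := by
  unfold cross
  rw [av_comm]
  refine congrArg av (funext fun v => congrArg av (funext fun u => ?_))
  rw [link_comm]
  congr 2
  simp only [mem_compl, not_not, and_comm]

/-- If the vertices have large links and the links across every balanced cut have positive
density, then any two vertices are connected by many lists of some bounded length. -/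
theorem exists_conn_ge [Nonempty V] (ht : 0 < t) {δ σ η c κ ε : ℝ} (hη : 0 ≤ η)
    (hdeg : ∀ x : V, δ + σ ≤ av fun y => ind (η ≤ link k t E x y)) (hσ : 0 ≤ σ)
    (hcut : ∀ X : Finset V, δ ≤ av (fun v => ind (v ∈ X)) → δ ≤ av (fun v => ind (v ∉ X)) →
      c ≤ cross k t E X) (hκ : κ ≤ clqDens k E t) (hε : 0 < ε) (hεc : ε ≤ c / 2)
    (hεη : ε ≤ σ * η) (hεκ : ε ≤ κ) {i : ℕ} (hi : 1 < i * ε) (x y : V) :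
    η * ε ^ i ≤ conn k t E (t - 1 + i * t) [x] [y] := by
  classical
  let R : ℕ → Finset V := fun i =>
    univ.filter fun y => η * ε ^ i ≤ conn k t E (t - 1 + i * t) [x] [y]
  have hR : ∀ i y, y ∈ R i ↔ η * ε ^ i ≤ conn k t E (t - 1 + i * t) [x] [y] := fun i y => by
    simp [R]
  have hstep : ∀ i y, ε ≤ av (fun u => ind (u ∈ R i) * link k t E u y) → y ∈ R (i + 1) := by
    intro i y h
    rw [hR]
    have h1 := conn_trans (E := E) (k := k) ht (t - 1 + i * t) x y
    have h2 : t - 1 + i * t + t = t - 1 + (i + 1) * t := by ring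
    rw [h2] at h1
    refine le_trans ?_ h1
    calc η * ε ^ (i + 1) = (η * ε ^ i) * ε := by ring
      _ ≤ (η * ε ^ i) * av (fun u => ind (u ∈ R i) * link k t E u y) := by gcongr
      _ = av fun u => (η * ε ^ i) * (ind (u ∈ R i) * link k t E u y) := (av_const_mul _ _).symm
      _ ≤ _ := by
        refine av_mono fun u => ?_
        by_cases hu : u ∈ R i
        · rw [ind_true hu, one_mul]
          exact mul_le_mul_of_nonneg_right ((hR i u).1 hu) (link_nonneg _ _)
        · rw [ind_false hu, zero_mul, mul_zero]
          exact mul_nonneg (conn_nonneg _ _ _) (link_nonneg _ _)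
  have hpad : ∀ i, R i ⊆ R (i + 1) := by
    intro i y hy
    rw [hR] at hy ⊢
    have h1 := conn_pad (k := k) (t := t) (E := E) (t - 1 + i * t) [x] [y]
    have h2 : t - 1 + i * t + t = t - 1 + (i + 1) * t := by ring
    rw [h2] at h1
    refine le_trans ?_ h1
    calc η * ε ^ (i + 1) = (η * ε ^ i) * ε := by ring
      _ ≤ _ := mul_le_mul hy (hεκ.trans hκ) hε.le (conn_nonneg _ _ _)
  have hgrow : ∀ i, (∀ y, y ∈ R i) ∨
      (δ ≤ av (fun v => ind (v ∈ R i)) ∧ i * ε ≤ av (fun v => ind (v ∈ R i))) := by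
    intro i
    induction i with
    | zero =>
      refine Or.inr ⟨?_, ?_⟩
      · refine le_trans (by linarith) ((hdeg x).trans (av_mono fun v => ind_mono fun h => ?_))
        rw [hR]
        simpa using h.trans (link_le_conn ht x v)
      · simpa using av_nonneg fun v => ind_nonneg _
    | succ i ih =>
      rcases ih with ih | ⟨ih1, ih2⟩
      · exact Or.inl fun y => hpad i (ih y)
      by_cases hlarge : δ ≤ av (fun v => ind (v ∉ R i))
      · right
        have hc := hcut _ ih1 hlarge
        have h1 := av_ind_ge (f := fun v => av fun u => ind (u ∈ R i ∧ v ∉ R i) * link k t E u v)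
          (a := ε) (b := 1) hε.le (fun v => by
            refine (av_mono fun u => ?_).trans (av_const 1).le
            exact mul_le_one₀ (ind_le_one _) (link_nonneg _ _) (link_le_one _ _))
        have h2 : av (fun v => ind (v ∈ R i)) +
            av (fun v => ind (ε ≤ av fun u => ind (u ∈ R i ∧ v ∉ R i) * link k t E u v)) ≤
              av (fun v => ind (v ∈ R (i + 1))) := by
          rw [← av_add]
          refine av_mono fun v => ?_
          by_cases hv : v ∈ R i
          · have : ¬ (ε ≤ av fun u => ind (u ∈ R i ∧ v ∉ R i) * link k t E u v) := by
              simp only [hv, not_true_eq_false, and_false, ind_false not_false, zero_mul, av_const]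
              exact not_le.2 hε
            rw [ind_false this, add_zero]
            exact ind_mono fun h => hpad i h
          · rw [ind_false hv, zero_add]
            refine ind_mono fun h => hstep i v (h.trans (av_mono fun u => ?_))
            exact mul_le_mul_of_nonneg_right (ind_mono fun h => h.1) (link_nonneg _ _)
        unfold cross at hc
        push_cast
        constructor <;> linarith
      · left
        intro y
        refine hstep i y ?_
        push Not at hlarge
        have h1 : av (fun u => ind (η ≤ link k t E y u)) ≤
            av (fun u => ind (u ∈ R i ∧ η ≤ link k t E y u)) + av (fun u => ind (u ∉ R i)) := by
          rw [← av_add]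
          refine av_mono fun u => ind_le_add fun h => ?_
          by_cases hu : u ∈ R i
          · exact Or.inl ⟨hu, h⟩
          · exact Or.inr hu
        have h2 : σ ≤ av (fun u => ind (u ∈ R i ∧ η ≤ link k t E y u)) := by
          linarith [hdeg y]
        calc ε ≤ σ * η := hεη
          _ ≤ av (fun u => ind (u ∈ R i ∧ η ≤ link k t E y u)) * η := by gcongr
          _ = av fun u => ind (u ∈ R i ∧ η ≤ link k t E y u) * η := (av_mul_const _ _).symm
          _ ≤ _ := by
            refine av_mono fun u => ?_
            by_cases hu : u ∈ R i ∧ η ≤ link k t E y u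
            · rw [ind_true hu, ind_true hu.1, one_mul, one_mul, link_comm]
              exact hu.2
            · rw [ind_false hu, zero_mul]
              exact mul_nonneg (ind_nonneg _) (link_nonneg _ _)
  rw [← hR]
  rcases hgrow i with h | ⟨-, h⟩
  · exact h y
  · have : av (fun v => ind (v ∈ R i)) ≤ 1 :=
      (av_mono fun v => ind_le_one _).trans (av_const 1).le
    linarith

end Links

theorem countP_eq_card_filter {V : Type*} [DecidableEq V] {q : List V} (hq : q.Nodup)
    (p : V → Prop) [DecidablePred p] :
    q.countP p = (q.toFinset.filter p).card := by
  rw [List.countP_eq_length_filter, ← List.toFinset_card_of_nodup (hq.filter _),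
    List.toFinset_filter]
  simp only [decide_eq_true_eq]

section Crossing

variable {V : Type*} [DecidableEq V] [Fintype V] {k t : ℕ} {E : Finset (Finset V)} {α : ℝ}

theorem choose_add_choose_le {p q : ℕ} (h : p ≤ q) (d r : ℕ) :
    (p + d).choose r + q.choose r ≤ p.choose r + (q + d).choose r := by
  cases r with
  | zero => simp
  | succ r =>
    induction d with
    | zero => simp
    | succ d ih =>
      have := Nat.choose_le_choose r (Nat.add_le_add_right h d)
      rw [← add_assoc, ← add_assoc, Nat.choose_succ_succ, Nat.choose_succ_succ]
      simp only [Nat.succ_eq_add_one]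
      omega

/-- Some vertex of `A` on the other side of the cut `X` than `v` lies in all `(k-1)`-subsets of `A`
which do not form an edge with `v`. -/
def Swappable (k : ℕ) (E : Finset (Finset V)) (X A : Finset V) (v : V) : Prop :=
  ∃ u ∈ A, (u ∈ X ↔ v ∉ X) ∧ ∀ T ∈ A.powersetCard (k - 1), insert v T ∉ E → u ∈ T

theorem two_le_swappable {X A : Finset V} {v : V} (h : ∃ u ∈ A, u ∈ X) (h' : ∃ u ∈ A, u ∉ X) :
    2 ≤ 2 * ind (Swappable k E X A v) + ∑ T ∈ A.powersetCard (k - 1),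
      (1 + ind (∀ u ∈ T, ¬ (u ∈ X ↔ v ∉ X))) * ind (insert v T ∉ E) := by
  have hterm : ∀ T ∈ A.powersetCard (k - 1),
      0 ≤ (1 + ind (∀ u ∈ T, ¬ (u ∈ X ↔ v ∉ X))) * ind (insert v T ∉ E) := fun T _ =>
    mul_nonneg (add_nonneg zero_le_one (ind_nonneg _)) (ind_nonneg _)
  by_cases hs : Swappable k E X A v
  · rw [ind_true hs, mul_one]
    exact le_add_of_nonneg_right (sum_nonneg hterm)
  rw [ind_false hs, mul_zero, zero_add]
  obtain ⟨u, hu, huv⟩ : ∃ u ∈ A, (u ∈ X ↔ v ∉ X) := by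
    by_cases hv : v ∈ X
    · obtain ⟨u, hu, hux⟩ := h'
      exact ⟨u, hu, by tauto⟩
    · obtain ⟨u, hu, hux⟩ := h
      exact ⟨u, hu, by tauto⟩
  obtain ⟨T, hT, hTE, hTu⟩ : ∃ T ∈ A.powersetCard (k - 1), insert v T ∉ E ∧ u ∉ T := by
    by_contra! hcon
    exact hs ⟨u, hu, huv, hcon⟩
  by_cases hTX : ∀ u ∈ T, ¬ (u ∈ X ↔ v ∉ X)
  · refine le_trans ?_ (single_le_sum hterm hT)
    rw [ind_true hTE, ind_true hTX]
    norm_num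
  push Not at hTX
  obtain ⟨w, hw, hwv⟩ := hTX
  obtain ⟨T', hT', hTE', hTw⟩ : ∃ T ∈ A.powersetCard (k - 1), insert v T ∉ E ∧ w ∉ T := by
    by_contra! hcon
    exact hs ⟨w, (mem_powersetCard.1 hT).1 hw, hwv, hcon⟩
  have hne : T ≠ T' := by
    rintro rfl
    exact hTw hw
  have h1 : ∀ S : Finset V, insert v S ∉ E →
      1 ≤ (1 + ind (∀ u ∈ S, ¬ (u ∈ X ↔ v ∉ X))) * ind (insert v S ∉ E) := fun S hS => by
    rw [ind_true hS, mul_one]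
    exact le_add_of_nonneg_right (ind_nonneg _)
  calc (2 : ℝ) = 1 + 1 := by norm_num
    _ ≤ _ := add_le_add (h1 T hTE) (h1 T' hTE')
    _ = ∑ S ∈ {T, T'}, (1 + ind (∀ u ∈ S, ¬ (u ∈ X ↔ v ∉ X))) * ind (insert v S ∉ E) :=
      (sum_pair (f := fun S => (1 + ind (∀ u ∈ S, ¬ (u ∈ X ↔ v ∉ X))) * ind (insert v S ∉ E))
        hne).symm
    _ ≤ _ := sum_le_sum_of_subset_of_nonneg
      (insert_subset hT (singleton_subset_iff.2 hT')) fun S hS _ => hterm S hS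

/-- The average number of weighted `(k-1)`-subsets not forming an edge with a vertex. -/
theorem av_sum_nonedge_le
    (hE : ∀ T : Finset V, T.card = k - 1 → av (fun v => ind (insert v T ∉ E)) ≤ α)
    (A : Finset V) (w : Finset V → ℝ) (hw : ∀ T, 0 ≤ w T) :
    (av fun v => ∑ T ∈ A.powersetCard (k - 1), w T * ind (insert v T ∉ E)) ≤
      α * ∑ T ∈ A.powersetCard (k - 1), w T := by
  have h3 : (av fun v => ∑ T ∈ A.powersetCard (k - 1), w T * ind (insert v T ∉ E)) =
      ∑ T ∈ A.powersetCard (k - 1), w T * av fun v => ind (insert v T ∉ E) := by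
    simp only [← av_const_mul]
    unfold av
    rw [sum_comm, sum_div]
  rw [h3, mul_sum]
  refine sum_le_sum fun T hT => ?_
  rw [mul_comm α]
  exact mul_le_mul_of_nonneg_left (hE T (mem_powersetCard.1 hT).2) (hw T)

theorem sum_powersetCard_ind_subset (A X : Finset V) (r : ℕ) :
    ∑ T ∈ A.powersetCard r, ind (T ⊆ X) = ((A.filter (· ∈ X)).card.choose r : ℝ) := by
  rw [sum_ind, ← card_powersetCard]
  congr 2
  ext T
  simp only [mem_filter, mem_powersetCard, subset_iff]
  constructor
  · rintro ⟨⟨h1, h2⟩, h3⟩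
    exact ⟨fun x hx => ⟨h1 hx, h3 hx⟩, h2⟩
  · rintro ⟨h1, h2⟩
    exact ⟨⟨fun x hx => (h1 hx).1, h2⟩, fun x hx => (h1 hx).2⟩

theorem swappable_ge [Nonempty V] (hα : 0 ≤ α)
    (hE : ∀ T : Finset V, T.card = k - 1 → av (fun v => ind (insert v T ∉ E)) ≤ α)
    {X A : Finset V} {l : ℕ} (hA : A.card = t) (hX : l + 1 ≤ (A.filter (· ∈ X)).card)
    (hX' : l + 1 ≤ (A.filter (· ∉ X)).card) :
    1 - α * ((t.choose (k - 1) : ℝ) + ((t - l - 1).choose (k - 1) : ℝ) +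
      ((l + 1).choose (k - 1) : ℝ)) / 2 ≤ av fun v => ind (Swappable k E X A v) := by
  have h1 : 2 ≤ 2 * (av fun v => ind (Swappable k E X A v)) + α *
      ∑ T ∈ A.powersetCard (k - 1), (1 + ind (T ⊆ X) + ind (T ⊆ Xᶜ)) := by
    refine le_trans ?_ (add_le_add_right (av_sum_nonedge_le hE A
      (fun T => 1 + ind (T ⊆ X) + ind (T ⊆ Xᶜ)) fun T => add_nonneg
        (add_nonneg zero_le_one (ind_nonneg _)) (ind_nonneg _)) _)
    rw [← av_const_mul, ← av_add]
    refine (av_const (V := V) 2).symm.le.trans (av_mono fun v => ?_)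
    obtain ⟨u, hu⟩ := card_pos.1 (show 0 < (A.filter (· ∈ X)).card by omega)
    obtain ⟨u', hu'⟩ := card_pos.1 (show 0 < (A.filter (· ∉ X)).card by omega)
    rw [mem_filter] at hu hu'
    refine (two_le_swappable (k := k) (E := E) (v := v) ⟨u, hu⟩ ⟨u', hu'⟩).trans ?_
    refine add_le_add_right (sum_le_sum fun T _ => mul_le_mul_of_nonneg_right ?_ (ind_nonneg _)) _
    rw [add_assoc]
    refine add_le_add_right ?_ _
    refine ind_le_add fun h => ?_
    by_cases hv : v ∈ X
    · refine Or.inl fun u hu => ?_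
      have := h u hu
      tauto
    · refine Or.inr fun u hu => ?_
      have := h u hu
      rw [mem_compl]
      tauto
  rw [sum_add_distrib, sum_add_distrib, sum_powersetCard_ind_subset, sum_powersetCard_ind_subset,
    sum_const, card_powersetCard, nsmul_eq_mul, mul_one, hA] at h1
  simp only [mem_compl] at h1
  have hsum : (A.filter (· ∈ X)).card + (A.filter (· ∉ X)).card = t := by
    rw [card_filter_add_card_filter_not, hA]
  have h2 := choose_add_choose_le hX' ((A.filter (· ∈ X)).card - (l + 1)) (k - 1)
  rw [show l + 1 + ((A.filter (· ∈ X)).card - (l + 1)) = (A.filter (· ∈ X)).card by omega,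
    show (A.filter (· ∉ X)).card + ((A.filter (· ∈ X)).card - (l + 1)) = t - l - 1 by omega] at h2
  have h3 : ((A.filter (· ∈ X)).card.choose (k - 1) : ℝ) +
      ((A.filter (· ∉ X)).card.choose (k - 1) : ℝ) ≤
      ((t - l - 1).choose (k - 1) : ℝ) + ((l + 1).choose (k - 1) : ℝ) := by
    rw [add_comm ((t - l - 1).choose (k - 1) : ℝ)]
    exact_mod_cast h2
  have h4 := mul_le_mul_of_nonneg_left h3 hα
  linarith

/-- Tetrahedra in `3`-graphs with exactly one vertex in a set containing half of the vertices. -/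
theorem swappable_ge_of_majority [Nonempty V]
    (hE : ∀ T : Finset V, T.card = 3 - 1 → av (fun v => ind (insert v T ∉ E)) ≤ α)
    {X A : Finset V} (hA : A.card = 4) (hX : (A.filter (· ∈ X)).card = 1)
    (hX' : 1 / 2 ≤ av fun v => ind (v ∈ X)) :
    (3 / 2 - 6 * α) / 2 ≤ av fun v => ind (Swappable 3 E X A v) := by
  have h1 : 1 + (av fun v => ind (v ∈ X)) ≤ 2 * (av fun v => ind (Swappable 3 E X A v)) + α *
      ∑ T ∈ A.powersetCard (3 - 1), (1 : ℝ) := by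
    refine le_trans ?_ (add_le_add_right (av_sum_nonedge_le hE A (fun T => 1) fun T => zero_le_one) _)
    rw [← av_const_mul, ← av_add, ← av_const (V := V) 1, ← av_add, av_const]
    refine av_mono fun v => ?_
    have hsum : (A.filter (· ∈ X)).card + (A.filter (· ∉ X)).card = 4 := by
      rw [card_filter_add_card_filter_not, hA]
    obtain ⟨u, hu⟩ := card_pos.1 (show 0 < (A.filter (· ∈ X)).card by omega)
    obtain ⟨u', hu'⟩ := card_pos.1 (show 0 < (A.filter (· ∉ X)).card by omega)
    rw [mem_filter] at hu hu'
    have h2 := two_le_swappable (k := 3) (E := E) (v := v) ⟨u, hu⟩ ⟨u', hu'⟩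
    by_cases hv : v ∈ X
    · rw [ind_true hv]
      refine le_trans (by norm_num) (h2.trans (add_le_add_right (sum_le_sum fun T hT => ?_) _))
      refine mul_le_mul_of_nonneg_right ?_ (ind_nonneg _)
      rw [ind_false, add_zero]
      intro h
      rw [mem_powersetCard] at hT
      have : T ⊆ A.filter (· ∈ X) := fun w hw => by
        have := h w hw
        rw [mem_filter]
        exact ⟨hT.1 hw, by tauto⟩
      have := card_le_card this
      omega
    · rw [ind_false hv]
      have h3 : ∑ T ∈ A.powersetCard (3 - 1),
          (1 + ind (∀ u ∈ T, ¬ (u ∈ X ↔ v ∉ X))) * ind (insert v T ∉ E) ≤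
          2 * ∑ T ∈ A.powersetCard (3 - 1), 1 * ind (insert v T ∉ E) := by
        rw [mul_sum]
        refine sum_le_sum fun T _ => ?_
        rw [one_mul]
        refine mul_le_mul_of_nonneg_right ?_ (ind_nonneg _)
        linarith [ind_le_one (∀ u ∈ T, ¬ (u ∈ X ↔ v ∉ X))]
      linarith [ind_nonneg (Swappable 3 E X A v)]
  rw [sum_const, card_powersetCard, hA, nsmul_eq_mul, mul_one] at h1
  have : ((Nat.choose 4 (3 - 1) : ℕ) : ℝ) = 6 := by norm_num [Nat.choose]
  rw [this] at h1
  linarith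

theorem avg_swap_eq (X : Finset V) :
    (av fun u => av fun v => ind (u ∈ X ↔ v ∉ X) * link k t E u v) = 2 * cross k t E X := by
  have h : ∀ u v, ind (u ∈ X ↔ v ∉ X) * link k t E u v =
      ind (v ∈ X ∧ u ∉ X) * link k t E v u + ind (u ∈ X ∧ v ∉ X) * link k t E u v := by
    intro u v
    rw [link_comm (x := v), ← add_mul]
    congr 1
    by_cases hu : u ∈ X <;> by_cases hv : v ∈ X <;> simp [ind, hu, hv]
  simp only [h, av_add]
  rw [av_comm fun u v => ind (u ∈ X ∧ v ∉ X) * link k t E u v]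
  unfold cross
  ring

/-- Many cliques with many swappable vertices give a dense cut. -/
theorem cross_ge [Nonempty V] {X : Finset V} {P : List V → Prop} {c τ : ℝ} (hτ : 0 ≤ τ)
    (hP : c ≤ avg t fun l => ind (P l)) (hn : (t : ℝ) * t / Fintype.card V ≤ c / 2)
    (h : ∀ l : List V, l.length = t → l.Nodup → P l →
      LClq k E l ∧ τ ≤ av fun v => ind (Swappable k E X l.toFinset v)) :
    c / 2 * τ ≤ t * (2 * cross k t E X) := by
  have h1 : c / 2 ≤ avg t fun l : List V => ind (P l ∧ l.Nodup) := by
    have h2 := avg_degenerate (V := V) t ∅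
    have h3 : (avg t fun l : List V => ind (P l)) ≤ (avg t fun l : List V => ind (P l ∧ l.Nodup)) +
        avg t fun l : List V => ind (¬ (l.Nodup ∧ Disjoint l.toFinset ∅)) := by
      rw [← avg_add]
      refine avg_mono fun l _ => ind_le_add fun hl => ?_
      simp only [disjoint_empty_right, and_true]
      tauto
    rw [card_empty, Nat.cast_zero, add_zero] at h2
    linarith
  let S : ℕ → List V → V → Prop := fun i l v => ∃ l₁ u l₂, l = l₁ ++ u :: l₂ ∧ l₁.length = i ∧
    (u ∈ X ↔ v ∉ X) ∧ LClq k E (u :: (l₁ ++ l₂)) ∧ LClq k E (v :: (l₁ ++ l₂))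
  have h2 : c / 2 * τ ≤ avg t fun l => av fun v => ∑ i ∈ range t, ind (S i l v) := by
    calc c / 2 * τ ≤ (avg t fun l : List V => ind (P l ∧ l.Nodup)) * τ := by gcongr
      _ = avg t fun l : List V => ind (P l ∧ l.Nodup) * τ := (avg_mul_const _ _ _).symm
      _ ≤ _ := avg_mono fun l hl => ?_
    by_cases hlP : P l ∧ l.Nodup
    · rw [ind_true hlP, one_mul]
      obtain ⟨hlc, hl2⟩ := h l hl hlP.2 hlP.1
      refine hl2.trans (av_mono fun v => ?_)
      by_cases hs : Swappable k E X l.toFinset v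
      · obtain ⟨u, hu, huv, hT⟩ := hs
        obtain ⟨l₁, l₂, rfl⟩ := List.append_of_mem (List.mem_toFinset.1 hu)
        have hperm : (l₁ ++ u :: l₂).Perm (u :: (l₁ ++ l₂)) := List.perm_middle
        have hnd := List.nodup_cons.1 (hperm.nodup_iff.1 hlP.2)
        have hc1 : LClq k E (u :: (l₁ ++ l₂)) := by
          rwa [LClq, ← List.toFinset_eq_of_perm _ _ hperm]
        have hsub : (l₁ ++ l₂).toFinset ⊆ (u :: (l₁ ++ l₂)).toFinset := by
          rw [List.toFinset_cons]
          exact subset_insert _ _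
        have hc2 : LClq k E (v :: (l₁ ++ l₂)) := by
          rw [LClq, List.toFinset_cons]
          refine IsClq.insert (IsClq.mono hc1 hsub) fun T hT' => ?_
          by_contra hcon
          rw [mem_powersetCard] at hT'
          refine hnd.1 (List.mem_toFinset.1 (hT'.1 (hT T (mem_powersetCard.2 ⟨?_, hT'.2⟩) hcon)))
          rw [List.toFinset_eq_of_perm _ _ hperm]
          exact hT'.1.trans hsub
        refine (ind_le_one _).trans ?_
        rw [← ind_true (show S l₁.length (l₁ ++ u :: l₂) v from
          ⟨l₁, u, l₂, rfl, rfl, huv, hc1, hc2⟩)]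
        refine single_le_sum (f := fun i => ind (S i (l₁ ++ u :: l₂) v))
          (fun i _ => ind_nonneg _) (mem_range.2 ?_)
        rw [← hl]
        simp
      · rw [ind_false hs]
        exact sum_nonneg fun i _ => ind_nonneg _
    · rw [ind_false hlP, zero_mul]
      exact av_nonneg fun v => sum_nonneg fun i _ => ind_nonneg _
  have h3 : ∀ i ∈ range t, (av fun v => avg t fun l => ind (S i l v)) ≤ 2 * cross k t E X := by
    intro i hi
    rw [mem_range] at hi
    rw [← avg_swap_eq, av_comm fun u v => ind (u ∈ X ↔ v ∉ X) * link k t E u v]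
    refine av_mono fun v => ?_
    have hti : t = i + ((t - 1 - i) + 1) := by omega
    calc (avg t fun l => ind (S i l v))
        = avg i fun l₁ => av fun u => avg (t - 1 - i) fun l₂ => ind (S i (l₁ ++ u :: l₂) v) := by
          conv_lhs => rw [hti, avg_append]
          rfl
      _ ≤ avg i fun l₁ => av fun u => ind (u ∈ X ↔ v ∉ X) * avg (t - 1 - i) fun l₂ =>
            ind (LClq k E (u :: (l₁ ++ l₂)) ∧ LClq k E (v :: (l₁ ++ l₂))) := by
          refine avg_mono fun l₁ hl₁ => av_mono fun u => ?_
          rw [← avg_const_mul]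
          refine avg_mono fun l₂ _ => ?_
          by_cases hs : S i (l₁ ++ u :: l₂) v
          · obtain ⟨m₁, w, m₂, heq, hm, hw, hc⟩ := hs
            obtain ⟨rfl, heq'⟩ := List.append_inj heq (by omega)
            rw [List.cons.injEq] at heq'
            obtain ⟨rfl, rfl⟩ := heq'
            rw [ind_true hw, ind_true hc, one_mul]
            exact ind_le_one _
          · rw [ind_false hs]
            exact mul_nonneg (ind_nonneg _) (ind_nonneg _)
      _ = av fun u => ind (u ∈ X ↔ v ∉ X) * link k t E u v := by
          rw [avg_av]
          refine congrArg av (funext fun u => ?_)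
          rw [avg_const_mul, link, ← avg_append i (t - 1 - i) fun l =>
            ind (LClq k E (u :: l) ∧ LClq k E (v :: l)), show i + (t - 1 - i) = t - 1 by omega]
  refine h2.trans ?_
  rw [avg_av]
  simp only [avg_sum]
  calc (av fun v => ∑ i ∈ range t, avg t fun l => ind (S i l v))
      = ∑ i ∈ range t, av fun v => avg t fun l => ind (S i l v) := by
        unfold av
        rw [sum_comm, sum_div]
    _ ≤ ∑ i ∈ range t, 2 * cross k t E X := sum_le_sum h3
    _ = _ := by rw [sum_const, card_range, nsmul_eq_mul]

/-- Many cliques have several vertices on both sides of a balanced cut. -/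
theorem avg_clique_split_ge [Nonempty V] (hk : 0 < k) (hα : 0 ≤ α)
    (hE : ∀ T : Finset V, T.card = k - 1 → av (fun v => ind (insert v T ∉ E)) ≤ α)
    {X : Finset V} {δ : ℝ} (hX : 1 / 2 ≤ av fun v => ind (v ∈ X))
    (hX' : δ ≤ av fun v => ind (v ∉ X)) {l j s : ℕ} (hs : l + j ≤ s) (hl : l + 1 + j ≤ t)
    (h1 : 0 ≤ δ - α * (l.choose (k - 1) : ℝ)) (h2 : 0 ≤ 1 / 2 - α * (s.choose (k - 1) : ℝ))
    (h3 : 0 ≤ 1 - α * ((t - 1).choose (k - 1) : ℝ)) :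
    (1 - α * ((t - 1).choose (k - 1) : ℝ)) ^ (t - (l + 1 + j)) *
      ((1 / 2 - α * (s.choose (k - 1) : ℝ)) ^ j * (δ - α * (l.choose (k - 1) : ℝ)) ^ (l + 1)) ≤
      avg t fun q : List V => ind (LClq k E q ∧ l + 1 ≤ q.countP (· ∉ X) ∧
        j ≤ q.countP (· ∈ X)) := by
  have s1 := avg_succ_iter (m := 0) (j := l + 1)
    (P := fun q : List V => LClq k E q ∧ ∀ u ∈ q, u ∉ X) (p := 1) h1
    (by
      simp only [avg]
      rw [ind_true]
      exact ⟨isClq_of_card_lt (by simpa using hk), by simp⟩)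
    (fun q hq hc => by
      refine (sub_le_sub_right hX' _).trans
        ((clique_extension hα hE (s := l) (by omega) hc.1 fun v => v ∉ X).trans ?_)
      refine av_mono fun v => ind_mono fun hv => ⟨hv.2, ?_⟩
      simp only [List.mem_cons, forall_eq_or_imp]
      exact ⟨hv.1, hc.2⟩)
  rw [mul_one, zero_add] at s1
  have s2 := avg_succ_iter (m := l + 1) (j := j)
    (P := fun q : List V => LClq k E q ∧ l + 1 ≤ q.countP (· ∉ X) ∧
      q.length ≤ q.countP (· ∈ X) + (l + 1)) h2
    (s1.trans (avg_mono fun q hq => ind_mono fun hc => by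
      refine ⟨hc.1, ?_, by omega⟩
      rw [List.countP_eq_length.2 (by simpa using hc.2), hq]))
    (fun q hq hc => by
      refine (sub_le_sub_right hX _).trans
        ((clique_extension hα hE (s := s) (by omega) hc.1 fun v => v ∈ X).trans ?_)
      refine av_mono fun v => ind_mono fun hv => ⟨hv.2, ?_⟩
      have := hv.1
      simp only [List.countP_cons, List.length_cons, decide_eq_true_eq, if_pos this]
      omega)
  have s3 := avg_succ_iter (m := l + 1 + j) (j := t - (l + 1 + j))
    (P := fun q : List V => LClq k E q ∧ l + 1 ≤ q.countP (· ∉ X) ∧ j ≤ q.countP (· ∈ X)) h3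
    (s2.trans (avg_mono fun q hq => ind_mono fun hc => by
      exact ⟨hc.1, hc.2.1, by omega⟩))
    (fun q hq hc => by
      refine (clique_extension_univ hα hE (s := t - 1) (by omega) hc.1).trans ?_
      refine av_mono fun v => ind_mono fun hv => ⟨hv, ?_⟩
      simp only [List.countP_cons]
      omega)
  rwa [Nat.add_sub_cancel' hl] at s3

end Crossing

section Factor

variable {k t : ℕ} {α δ : ℝ}

theorem exists_cross_ge_of_swappable (hk : 0 < k) (hα : 0 ≤ α)
    (he : 0 < 1 - α * ((t - 1).choose (k - 1) : ℝ)) {l j s : ℕ} (hs : l + j ≤ s)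
    (hl : l + 1 + j ≤ t) (h1 : 0 < δ - α * (l.choose (k - 1) : ℝ))
    (h2 : 0 < 1 / 2 - α * (s.choose (k - 1) : ℝ)) {τ : ℝ} (hτ : 0 < τ) :
    ∃ c > 0, ∃ n₀ : ℕ, ∀ n : ℕ, n₀ ≤ n → ∀ E : Finset (Finset (Fin n)),
      (∀ T : Finset (Fin n), T.card = k - 1 → av (fun v => ind (insert v T ∉ E)) ≤ α) →
      (∀ X A : Finset (Fin n), 1 / 2 ≤ av (fun v => ind (v ∈ X)) → A.card = t →
        l + 1 ≤ (A.filter (· ∉ X)).card → j ≤ (A.filter (· ∈ X)).card →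
        τ ≤ av fun v => ind (Swappable k E X A v)) →
      ∀ X : Finset (Fin n), δ ≤ av (fun v => ind (v ∈ X)) → δ ≤ av (fun v => ind (v ∉ X)) →
        c ≤ cross k t E X := by
  set c := (1 - α * ((t - 1).choose (k - 1) : ℝ)) ^ (t - (l + 1 + j)) *
      ((1 / 2 - α * (s.choose (k - 1) : ℝ)) ^ j * (δ - α * (l.choose (k - 1) : ℝ)) ^ (l + 1))
    with hc
  have hc0 : 0 < c := by positivity
  have ht : (0 : ℝ) < t := by
    have : 0 < t := by omega
    exact_mod_cast this
  obtain ⟨n₁, hn₁⟩ := exists_nat_ge ((t : ℝ) * t / (c / 2))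
  refine ⟨c / 2 * τ / (t * 2), by positivity, n₁ + 1, fun n hn E hE hsw => ?_⟩
  have : Nonempty (Fin n) := ⟨⟨0, by omega⟩⟩
  have hn' : (t : ℝ) * t / Fintype.card (Fin n) ≤ c / 2 := by
    have hn0 : (0 : ℝ) < n := by
      have : 0 < n := by omega
      exact_mod_cast this
    have h3 : (n₁ : ℝ) ≤ n := by exact_mod_cast (show n₁ ≤ n by omega)
    rw [Fintype.card_fin, div_le_iff₀ hn0]
    rw [div_le_iff₀ (by positivity)] at hn₁
    nlinarith
  have hmaj : ∀ X : Finset (Fin n), 1 / 2 ≤ av (fun v => ind (v ∈ X)) →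
      δ ≤ av (fun v => ind (v ∉ X)) → c / 2 * τ / (t * 2) ≤ cross k t E X := by
    intro X hX hX'
    have h3 := cross_ge hτ.le (avg_clique_split_ge hk hα hE hX hX' hs hl h1.le h2.le he.le) hn'
      (k := k) (E := E) (X := X) fun q hq hnd hc => ⟨hc.1, hsw X _ hX
        (by rw [List.toFinset_card_of_nodup hnd, hq])
        (by rw [← countP_eq_card_filter hnd]; exact hc.2.1)
        (by rw [← countP_eq_card_filter hnd]; exact hc.2.2)⟩
    rw [div_le_iff₀ (by positivity)]
    linarith
  intro X hX hX'
  rcases le_total (1 / 2) (av fun v => ind (v ∈ X)) with h | h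
  · exact hmaj X h hX'
  · rw [← cross_compl]
    refine hmaj _ ?_ (by simpa only [mem_compl, not_not] using hX)
    have h3 : (av fun v => ind (v ∈ X)) + (av fun v => ind (v ∈ Xᶜ)) = 1 := by
      rw [← av_add, ← av_const (V := Fin n) 1]
      refine congrArg av (funext fun v => ?_)
      by_cases hv : v ∈ X <;> simp [ind, hv]
    linarith

/-- If the links across balanced cuts are dense then all pairs of vertices are connected. -/
theorem exists_forall_conn_ge (hk : 2 ≤ k) (ht : 0 < t) (hα : 0 ≤ α) {e σ : ℝ}
    (he : e = 1 - α * ((t - 1).choose (k - 1) : ℝ)) (he0 : 0 < e) (hσ : 0 < σ)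
    (hcross : ∃ c > 0, ∃ n₀ : ℕ, ∀ n : ℕ, n₀ ≤ n → ∀ E : Finset (Finset (Fin n)),
      (∀ T : Finset (Fin n), T.card = k - 1 → av (fun v => ind (insert v T ∉ E)) ≤ α) →
      ∀ X : Finset (Fin n), e - 2 * σ ≤ av (fun v => ind (v ∈ X)) →
        e - 2 * σ ≤ av (fun v => ind (v ∉ X)) → c ≤ cross k t E X) :
    ∃ m : ℕ, ∃ η > 0, ∃ n₀ : ℕ, ∀ n : ℕ, n₀ ≤ n → ∀ E : Finset (Finset (Fin n)),
      (∀ T : Finset (Fin n), T.card = k - 1 → av (fun v => ind (insert v T ∉ E)) ≤ α) →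
      ∀ x y, η ≤ conn k t E m [x] [y] := by
  obtain ⟨c, hc, n₀, hcut⟩ := hcross
  set η := σ * e ^ (t - 1) with hη
  have hη0 : 0 < η := by positivity
  set ε := min (c / 2) (min (σ * η) (e ^ t)) with hε
  have hε0 : 0 < ε := by positivity
  obtain ⟨i, hi⟩ := exists_nat_gt (1 / ε)
  rw [div_lt_iff₀ hε0] at hi
  refine ⟨t - 1 + i * t, η * ε ^ i, by positivity, n₀ + 1, fun n hn E hE x y => ?_⟩
  have : Nonempty (Fin n) := ⟨x⟩
  refine exists_conn_ge (δ := e - 2 * σ) (σ := σ) (κ := e ^ t) ht hη0.le (fun x => ?_) hσ.le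
    (hcut n (by omega) E hE) ?_ hε0 (min_le_left _ _) ((min_le_right _ _).trans (min_le_left _ _))
    ((min_le_right _ _).trans (min_le_right _ _)) hi x y
  · exact le_trans (by linarith) (link_degree hk hα hE he he0 hσ.le x)
  · rw [he] at he0 ⊢
    exact clqDens_ge (by omega) hα hE he0.le

/-- Connectedness and the extension property for cliques guarantee a perfect tiling. -/
theorem exists_tiled_univ (hk : 2 ≤ k) (hkt : k < t) (hα : 0 ≤ α)
    (he : 0 < 1 - α * ((t - 1).choose (k - 1) : ℝ)) {γ : ℝ} (hγ : 0 < γ)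
    (hext : ∀ s, 1 ≤ s → s < t → α * (s.choose (k - 1) : ℝ) ≤ s / t - γ)
    (hconn : ∃ m : ℕ, ∃ η > 0, ∃ n₀ : ℕ, ∀ n : ℕ, n₀ ≤ n → ∀ E : Finset (Finset (Fin n)),
      (∀ T : Finset (Fin n), T.card = k - 1 → av (fun v => ind (insert v T ∉ E)) ≤ α) →
      ∀ x y, η ≤ conn k t E m [x] [y]) :
    ∃ n₀ : ℕ, ∀ n : ℕ, n₀ ≤ n → t ∣ n → ∀ E : Finset (Finset (Fin n)),
      (∀ T : Finset (Fin n), T.card = k - 1 → av (fun v => ind (insert v T ∉ E)) ≤ α) →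
      Tiled k t E (univ : Finset (Fin n)) := by
  classical
  obtain ⟨m, η, hη, n₁, hconn⟩ := hconn
  set a := min (η ^ t * (1 - α * ((t - 1).choose (k - 1) : ℝ)) ^ t) 1 with ha
  have ha0 : 0 < a := by positivity
  obtain ⟨n₂, hcount⟩ := exists_absorber_count ha0 (min_le_right _ _) (half_pos hγ)
    (t * m + t) t (t ^ 3)
  obtain ⟨n₃, hn₃⟩ := exists_nat_gt (2 * (t + (t : ℝ) ^ 2) / γ)
  have ht : (0 : ℝ) < t := by
    have : 0 < t := by omega
    exact_mod_cast this
  refine ⟨n₁ + n₂ + n₃ + 1, fun n hn htn E hE => ?_⟩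
  have : Nonempty (Fin n) := ⟨⟨0, by omega⟩⟩
  obtain ⟨r, hr₁, hr₂, hr₃⟩ := hcount n (by omega)
  obtain ⟨U, hUc, hU, hUW⟩ := exists_absorbing_set (k := k) (t := t) (E := E) ha0 (min_le_right _ _)
    (fun Q hQ => ((min_le_left _ _).trans (by
      gcongr
      exact clqDens_ge (by omega) hα hE he.le)).trans
        (absorbs_dens hη.le (hconn n (by omega) E hE) Q hQ)) r (t ^ 3)
    (by rw [Fintype.card_fin]; exact hr₁) (by rw [Fintype.card_fin]; exact hr₂)
  have hUn : (U.card : ℝ) ≤ γ / 2 * n := le_trans (by exact_mod_cast hUc) hr₃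
  have hn₃' : 2 * (t + (t : ℝ) ^ 2) < γ * n := by
    rw [div_lt_iff₀ hγ] at hn₃
    have : (n₃ : ℝ) ≤ n := by exact_mod_cast (show n₃ ≤ n by omega)
    nlinarith
  obtain ⟨S, hSW, hS, hSc⟩ := exists_almost_tiling (E := E) hk hkt Uᶜ fun A hAW hA hAt hAc => by
    have h1 := clique_extension_univ hα hE (l := A.toList) (s := A.card) (by simp)
      (by simpa [LClq] using hAc)
    rw [av_ind, le_div_iff₀ (by rw [Fintype.card_fin]; exact_mod_cast (show 0 < n by omega)),
      Fintype.card_fin] at h1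
    have h2 : (univ.filter fun v => LClq k E (v :: A.toList)) ⊆
        (Uᶜ.filter fun v => v ∉ A ∧ IsClq k E (insert v A)) ∪ (U ∪ A) := by
      intro v hv
      simp only [LClq, List.toFinset_cons, toList_toFinset, mem_filter, mem_univ, true_and] at hv
      simp only [mem_union, mem_filter, mem_compl]
      tauto
    have h3 : ((univ.filter fun v => LClq k E (v :: A.toList)).card : ℝ) ≤
        (Uᶜ.filter fun v => v ∉ A ∧ IsClq k E (insert v A)).card + (U.card + A.card) := by
      exact_mod_cast (card_le_card h2).trans ((card_union_le _ _).trans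
        (Nat.add_le_add_left (card_union_le _ _) _))
    have h4 := hext A.card hA.card_pos hAt
    have h5 : ((Uᶜ : Finset (Fin n)).card : ℝ) ≤ n := by
      exact_mod_cast (card_le_univ _).trans (Fintype.card_fin n).le
    have h6 : (A.card : ℝ) ≤ t := by exact_mod_cast hAt.le
    have h7 : α * (A.card.choose (k - 1) : ℝ) * t ≤ A.card - γ * t := by
      have := mul_le_mul_of_nonneg_right h4 ht.le
      rwa [sub_mul, div_mul_cancel₀ _ ht.ne'] at this
    have hn0 : (0 : ℝ) ≤ n := Nat.cast_nonneg n
    have h8 := mul_le_mul_of_nonneg_right h7 hn0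
    have h9 : ((t : ℝ) - A.card) * (Uᶜ : Finset (Fin n)).card ≤ (t - A.card) * n :=
      mul_le_mul_of_nonneg_left h5 (by linarith)
    have h10 := mul_le_mul_of_nonneg_left (h1.trans h3) ht.le
    have h11 := mul_le_mul_of_nonneg_left hUn ht.le
    have h12 := mul_le_mul_of_nonneg_left h6 ht.le
    have h13 := mul_lt_mul_of_pos_left hn₃' ht
    have h14 : ((t : ℝ) - A.card) * (Uᶜ : Finset (Fin n)).card + t ^ 3 <
        t * (Uᶜ.filter fun v => v ∉ A ∧ IsClq k E (insert v A)).card := by nlinarith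
    rw [← Nat.cast_sub hAt.le] at h14
    exact_mod_cast h14
  have hdis : Disjoint (Uᶜ \ S) U := disjoint_compl_left.mono_left sdiff_subset
  have hcard : (Uᶜ \ S).card + U.card + S.card = n := by
    rw [card_sdiff_of_subset hSW, card_compl, Fintype.card_fin]
    have := card_le_card hSW
    have h15 := card_le_univ U
    rw [card_compl, Fintype.card_fin] at this
    rw [Fintype.card_fin] at h15
    omega
  obtain ⟨j, hj⟩ : t ∣ (Uᶜ \ S).card := by
    have h16 := hU.dvd_card
    have h17 := hS.dvd_card
    rw [← hcard] at htn
    exact (Nat.dvd_add_left h16).1 ((Nat.dvd_add_left h17).1 htn)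
  have h18 := hUW j (by nlinarith) (Uᶜ \ S) (by rw [hj, mul_comm]) hdis
  have h19 := h18.union hS (by
    rw [disjoint_union_left]
    exact ⟨sdiff_disjoint, disjoint_compl_right.mono_right hSW⟩)
  convert h19
  ext v
  simp only [mem_univ, mem_union, mem_sdiff, mem_compl, true_iff]
  tauto

theorem Tiled.hasFactorOn {n : ℕ} {E : Finset (Finset (Fin n))} {S : Finset (Fin n)}
    (h : Tiled k t E S) : HasFactorOn E (cliqueEdges t k) S := by
  induction h with
  | empty => exact ⟨∅, by simp, by simp, by simp⟩
  | cons A S hA hc hd _ ih =>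
    obtain ⟨P, hP, hPd, hPS⟩ := ih
    refine ⟨insert A P, ?_, ?_, by rw [biUnion_insert, hPS, id]⟩
    · intro B hB
      rcases mem_insert.1 hB with rfl | hB
      · refine ⟨(B.orderEmbOfFin hA).toEmbedding, ?_, fun e he => hc _ ?_ ?_⟩
        · rw [← coe_inj]
          simp
        · intro v hv
          rw [mem_map] at hv
          obtain ⟨u, -, rfl⟩ := hv
          exact orderEmbOfFin_mem B hA u
        · rw [card_map]
          exact (mem_powersetCard.1 he).2
      · exact hP B hB
    · rw [coe_insert]
      refine hPd.insert fun B hB _ => ?_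
      exact hd.mono_right (hPS ▸ subset_biUnion_of_mem id hB)

end Factor

section Threshold

variable {k t : ℕ} {α : ℝ}

/-- The lower bound on the degree of `T` bounds the number of vertices not forming an edge
with `T`. -/
theorem av_nonedge_le_of_degOn {n : ℕ} (hn : 0 < n) (hk : 0 < k) {E : Finset (Finset (Fin n))}
    {T : Finset (Fin n)} (hT : T.card = k - 1) (h : (1 - α) * n ≤ (degOn E k T : ℝ)) :
    av (fun v => ind (insert v T ∉ E)) ≤ α := by
  have h1 : degOn E k T ≤ (univ.filter fun v => insert v T ∈ E).card := by
    rw [degOn, ← card_image_of_injective (univ.filter fun v => insert v T ∈ E)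
      (singleton_injective (α := Fin n)), ← Set.ncard_coe_finset (image _ _)]
    refine Set.ncard_le_ncard ?_ (finite_toSet _)
    rintro S ⟨hS, -, hST⟩
    rw [hT, show k - (k - 1) = 1 by omega, card_eq_one] at hS
    obtain ⟨v, rfl⟩ := hS
    simp only [coe_image, Set.mem_image, mem_coe, mem_filter, mem_univ, true_and]
    exact ⟨v, by rwa [insert_eq], rfl⟩
  have h2 : (univ.filter fun v => insert v T ∈ E).card +
      (univ.filter fun v => insert v T ∉ E).card = n := by
    rw [card_filter_add_card_filter_not, card_univ, Fintype.card_fin]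
  have h3 : ((univ.filter fun v => insert v T ∈ E).card : ℝ) +
      ((univ.filter fun v => insert v T ∉ E).card : ℝ) = n := by exact_mod_cast h2
  have h4 : (degOn E k T : ℝ) ≤ (univ.filter fun v => insert v T ∈ E).card := by exact_mod_cast h1
  have hn' : (0 : ℝ) < n := by exact_mod_cast hn
  rw [av_ind, Fintype.card_fin, div_le_iff₀ hn']
  linarith

theorem mul_choose_le_mul_choose {r s m : ℕ} (hr : 0 < r) (hs : 0 < s) (hsm : s ≤ m) :
    m * s.choose r ≤ s * m.choose r := by
  obtain ⟨r, rfl⟩ := Nat.exists_eq_add_of_lt hr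
  obtain ⟨s, rfl⟩ := Nat.exists_eq_add_of_lt hs
  obtain ⟨m, rfl⟩ := Nat.exists_eq_add_of_lt (hs.trans_le hsm)
  simp only [zero_add] at *
  have h1 := Nat.add_one_mul_choose_eq s r
  have h2 := Nat.add_one_mul_choose_eq m r
  have h3 : s.choose r ≤ m.choose r := Nat.choose_le_choose r (by omega)
  refine Nat.le_of_mul_le_mul_right (c := r + 1) ?_ (by omega)
  rw [mul_assoc, mul_assoc, ← h1, ← h2]
  calc (m + 1) * ((s + 1) * s.choose r) = (s + 1) * ((m + 1) * s.choose r) := by ring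
    _ ≤ _ := by gcongr

theorem mul_choose_le_sub (hk : 3 ≤ k) {γ : ℝ} (hγ : 0 < γ)
    (h : α ≤ ((t : ℝ) - 1) / ((t : ℝ) * ((t - 1).choose (k - 1) : ℝ)) - γ) {s : ℕ} (hs : 1 ≤ s)
    (hst : s < t) : α * (s.choose (k - 1) : ℝ) ≤ s / t - min γ (1 / t) := by
  have ht : (0 : ℝ) < t := by exact_mod_cast (show 0 < t by omega)
  rcases lt_or_ge s (k - 1) with hsk | hsk
  · rw [Nat.choose_eq_zero_of_lt hsk, Nat.cast_zero, mul_zero, sub_nonneg]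
    refine (min_le_right _ _).trans ?_
    gcongr
    exact_mod_cast hs
  have hC : (0 : ℝ) < ((t - 1).choose (k - 1) : ℝ) := by
    exact_mod_cast Nat.choose_pos (by omega)
  have hC' : (1 : ℝ) ≤ (s.choose (k - 1) : ℝ) := by
    exact_mod_cast Nat.choose_pos hsk
  have h1 : ((t : ℝ) - 1) * (s.choose (k - 1) : ℝ) ≤ s * ((t - 1).choose (k - 1) : ℝ) := by
    have := mul_choose_le_mul_choose (r := k - 1) (s := s) (m := t - 1) (by omega) hs (by omega)
    have h2 : ((t - 1 : ℕ) : ℝ) * (s.choose (k - 1) : ℝ) ≤ s * ((t - 1).choose (k - 1) : ℝ) := by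
      exact_mod_cast this
    rwa [Nat.cast_sub (by omega), Nat.cast_one] at h2
  have h3 : ((t : ℝ) - 1) / ((t : ℝ) * ((t - 1).choose (k - 1) : ℝ)) * (s.choose (k - 1) : ℝ) ≤
      s / t := by
    rw [div_mul_eq_mul_div, div_le_div_iff₀ (by positivity) ht]
    nlinarith
  have h4 := mul_le_mul_of_nonneg_right h (zero_le_one.trans hC')
  have h5 := min_le_left γ (1 / (t : ℝ))
  nlinarith

theorem betaL_pos (hkt : k < t) (l : ℕ) : 0 < betaL k t l := by
  have : (0 : ℝ) < (t.choose (k - 1) : ℝ) := by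
    exact_mod_cast Nat.choose_pos (by omega)
  unfold betaL
  positivity

theorem goodL_zero (hk : 4 ≤ k) (hkt : k < t) : GoodL k t 0 := by
  have h1 : Nat.choose 0 (k - 1) = 0 := Nat.choose_eq_zero_of_lt (by omega)
  have h2 : Nat.choose 1 (k - 1) = 0 := Nat.choose_eq_zero_of_lt (by omega)
  have h3 : (t - 1).choose (k - 1) ≤ t.choose (k - 1) := Nat.choose_le_choose _ (by omega)
  have h4 : (0 : ℝ) < ((t - 1).choose (k - 1) : ℝ) := by
    exact_mod_cast Nat.choose_pos (by omega)
  have h5 : ((t - 1).choose (k - 1) : ℝ) ≤ (t.choose (k - 1) : ℝ) := by exact_mod_cast h3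
  refine ⟨by omega, ?_, by simp [h2]⟩
  simp only [betaL, Nat.sub_zero, zero_add, h1, h2, Nat.cast_zero, add_zero]
  rw [div_le_div_iff₀ (by positivity) h4]
  linarith

theorem goodL_l0 (hk : 3 ≤ k) (hkt : k < t) (h : ¬ (k = 3 ∧ t = 4)) : GoodL k t (l0 k t) := by
  unfold l0
  split_ifs with h3
  · subst h3
    obtain ⟨u, rfl⟩ : ∃ u, t = u + 5 := ⟨t - 5, by omega⟩
    have h1 : 10 ≤ (u + 5).choose 2 := Nat.choose_le_choose (a := 5) 2 (by omega)
    have h2 : 3 ≤ (u + 3).choose 2 := Nat.choose_le_choose (a := 3) 2 (by omega)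
    have h4 : 2 * (u + 4).choose 2 ≤ (u + 5).choose 2 + (u + 3).choose 2 := by
      have e1 : (u + 5).choose 2 = (u + 4).choose 1 + (u + 4).choose 2 := rfl
      have e2 : (u + 4).choose 2 = (u + 3).choose 1 + (u + 3).choose 2 := rfl
      rw [Nat.choose_one_right] at e1 e2
      omega
    have h1' : (10 : ℝ) ≤ ((u + 5).choose 2 : ℝ) := by exact_mod_cast h1
    have h2' : (3 : ℝ) ≤ ((u + 3).choose 2 : ℝ) := by exact_mod_cast h2
    have h4' : 2 * ((u + 4).choose 2 : ℝ) ≤ ((u + 5).choose 2 : ℝ) + ((u + 3).choose 2 : ℝ) := by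
      exact_mod_cast h4
    have h5 : (0 : ℝ) < ((u + 4).choose 2 : ℝ) := by
      exact_mod_cast Nat.choose_pos (by omega)
    refine ⟨by omega, ?_, fun _ => ?_⟩
    · simp only [betaL, Nat.reduceSub, Nat.reduceAdd, Nat.choose_self, Nat.cast_one,
        show u + 5 - 1 = u + 4 by omega, show u + 4 - 1 = u + 3 by omega,
        show Nat.choose 1 2 = 0 by decide, Nat.cast_zero, add_zero]
      rw [div_le_div_iff₀ (by positivity) h5]
      linarith
    · simp only [betaL, Nat.reduceSub, Nat.reduceAdd, Nat.reduceMul, Nat.choose_self, Nat.cast_one,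
        show u + 5 - 1 - 1 = u + 3 by omega, show Nat.choose 3 2 = 3 by decide]
      rw [div_le_div_iff₀ (by positivity) (by norm_num)]
      push_cast
      linarith
  · refine Nat.sSup_mem (s := {l | GoodL k t l}) ⟨0, goodL_zero (by omega) hkt⟩ ⟨t, fun l hl => ?_⟩
    have := hl.1
    omega

theorem mul_lt_one_of_le_one_div {β c : ℝ} (h : α < β) (hc : 0 < c) (hβ : β ≤ 1 / c) :
    α * c < 1 := by
  rw [le_div_iff₀ hc] at hβ
  nlinarith

/-- Below the threshold, every balanced cut is crossed by many links. -/
theorem exists_cross_ge (hk : 3 ≤ k) (hkt : k < t) (hα : 0 ≤ α) (hβ : α < betaKT k t) {e : ℝ}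
    (he : e = 1 - α * ((t - 1).choose (k - 1) : ℝ)) (he0 : 0 < e) :
    ∃ σ > 0, ∃ c > 0, ∃ n₀ : ℕ, ∀ n : ℕ, n₀ ≤ n → ∀ E : Finset (Finset (Fin n)),
      (∀ T : Finset (Fin n), T.card = k - 1 → av (fun v => ind (insert v T ∉ E)) ≤ α) →
      ∀ X : Finset (Fin n), e - 2 * σ ≤ av (fun v => ind (v ∈ X)) →
        e - 2 * σ ≤ av (fun v => ind (v ∉ X)) → c ≤ cross k t E X := by
  by_cases h34 : k = 3 ∧ t = 4
  · obtain ⟨rfl, rfl⟩ := h34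
    have hβ' : α < 1 / 4 := by
      simp only [betaKT, l0, if_pos, betaL] at hβ
      norm_num [Nat.choose] at hβ
      linarith
    refine ⟨e / 4, by positivity, ?_⟩
    obtain ⟨c, hc, n₀, h⟩ := exists_cross_ge_of_swappable (k := 3) (t := 4) (α := α)
      (δ := e - 2 * (e / 4)) (l := 1) (j := 1) (s := 2) (τ := min (1 - 4 * α) ((3 / 2 - 6 * α) / 2))
      (by norm_num) hα (by rwa [← he]) (by norm_num) (by norm_num)
      (by norm_num [Nat.choose]; linarith) (by norm_num [Nat.choose]; linarith)
      (lt_min (by linarith) (by linarith))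
    refine ⟨c, hc, n₀ + 1, fun n hn E hE => h n (by omega) E hE fun X A hX hA h1 h2 => ?_⟩
    have : Nonempty (Fin n) := ⟨⟨0, by omega⟩⟩
    rcases h2.eq_or_lt with h2 | h2
    · exact (min_le_right _ _).trans (swappable_ge_of_majority hE hA h2.symm hX)
    · refine (min_le_left _ _).trans (le_trans (le_of_eq ?_)
        (swappable_ge hα hE (l := 1) hA h2 h1))
      norm_num [Nat.choose]
      ring
  · obtain ⟨hl, hg1, hg2⟩ := goodL_l0 hk hkt h34
    unfold betaKT at hβ
    set l := l0 k t
    have hC : (0 : ℝ) < ((t - 1).choose (k - 1) : ℝ) := by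
      exact_mod_cast Nat.choose_pos (by omega)
    have hC' : (0 : ℝ) < (t.choose (k - 1) : ℝ) := by
      exact_mod_cast Nat.choose_pos (by omega)
    have h1 := mul_lt_one_of_le_one_div hβ (by positivity) hg1
    have h2 : 0 < 1 / 2 - α * ((2 * l + 1).choose (k - 1) : ℝ) := by
      rcases Nat.eq_zero_or_pos ((2 * l + 1).choose (k - 1)) with h0 | h0
      · rw [h0]
        norm_num
      · have h0' : (0 : ℝ) < ((2 * l + 1).choose (k - 1) : ℝ) := by exact_mod_cast h0
        have := mul_lt_one_of_le_one_div hβ (by positivity) (hg2 h0)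
        linarith
    have h3 : 0 < 1 - α * ((t.choose (k - 1) : ℝ) + ((t - l - 1).choose (k - 1) : ℝ) +
        ((l + 1).choose (k - 1) : ℝ)) / 2 := by
      rw [betaL, lt_div_iff₀ (by positivity)] at hβ
      linarith
    refine ⟨(1 - α * (((t - 1).choose (k - 1) : ℝ) + (l.choose (k - 1) : ℝ))) / 4,
      by linarith, ?_⟩
    obtain ⟨c, hc, n₀, h⟩ := exists_cross_ge_of_swappable (k := k) (t := t) (α := α)
      (δ := e - 2 * ((1 - α * (((t - 1).choose (k - 1) : ℝ) + (l.choose (k - 1) : ℝ))) / 4))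
      (l := l) (j := l + 1) (s := 2 * l + 1) (by omega) hα (by rwa [← he]) (by omega) (by omega)
      (by rw [he]; linarith) h2 h3
    refine ⟨c, hc, n₀ + 1, fun n hn E hE => h n (by omega) E hE fun X A _ hA h4 h5 => ?_⟩
    have : Nonempty (Fin n) := ⟨⟨0, by omega⟩⟩
    exact swappable_ge hα hE hA h5 h4

end Threshold

/-- Upper bound for the codegree threshold for `K_t^k`-factors. -/
theorem Kt_factor_threshold (k t : ℕ) (hk : 3 ≤ k) (hkt : k < t) (γ : ℝ) (hγ : 0 < γ) :
    ∃ n₀ : ℕ, ∀ n : ℕ, n₀ ≤ n → t ∣ n →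
      ∀ E : Finset (Finset (Fin n)), (∀ e ∈ E, e.card = k) →
      (∀ T : Finset (Fin n), T.card = k - 1 →
        (1 - min (betaKT k t) (((t : ℝ) - 1) / ((t : ℝ) * ((t - 1).choose (k - 1) : ℝ))) + γ)
          * n ≤ (degOn E k T : ℝ)) →
      HasFactorOn E (cliqueEdges t k) (Finset.univ : Finset (Fin n)) := by
  have ht : (1 : ℝ) < t := by exact_mod_cast (show 1 < t by omega)
  have hC : (0 : ℝ) < ((t - 1).choose (k - 1) : ℝ) := by
    exact_mod_cast Nat.choose_pos (by omega)
  set b := min (betaKT k t) (((t : ℝ) - 1) / ((t : ℝ) * ((t - 1).choose (k - 1) : ℝ))) with hb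
  have hb0 : 0 < b := lt_min (betaL_pos hkt _) (div_pos (by linarith) (by positivity))
  have hg0 : 0 < min γ (b / 2) := by positivity
  set α := b - min γ (b / 2) with hα
  have hα0 : 0 ≤ α := by
    have := min_le_right γ (b / 2)
    linarith
  have hα1 : α < betaKT k t := lt_of_lt_of_le (by linarith) (min_le_left _ _)
  have hα2 : α ≤ ((t : ℝ) - 1) / ((t : ℝ) * ((t - 1).choose (k - 1) : ℝ)) - min γ (b / 2) :=
    sub_le_sub_right (min_le_right _ _) _
  have hg1 : 0 < min (min γ (b / 2)) (1 / (t : ℝ)) := by positivity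
  have hext := fun s => mul_choose_le_sub hk hg0 hα2 (s := s)
  have he : 0 < 1 - α * ((t - 1).choose (k - 1) : ℝ) := by
    have h1 := hext (t - 1) (by omega) (by omega)
    have h2 : ((t - 1 : ℕ) : ℝ) / t ≤ 1 := by
      rw [div_le_one (by linarith)]
      exact_mod_cast Nat.sub_le t 1
    linarith
  obtain ⟨σ, hσ, hcross⟩ := exists_cross_ge hk hkt hα0 hα1 rfl he
  obtain ⟨n₀, h⟩ := exists_tiled_univ (by omega) hkt hα0 he hg1 hext
    (exists_forall_conn_ge (by omega) (by omega) hα0 rfl he hσ hcross)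
  refine ⟨n₀ + 1, fun n hn htn E _ hE => (h n (by omega) htn E fun T hT => ?_).hasFactorOn⟩
  refine av_nonedge_le_of_degOn (by omega) (by omega) hT (le_trans ?_ (hE T hT))
  have := min_le_left γ (b / 2)
  gcongr
  linarith
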